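/- Let λ>0 and 0<q<p<∞ with p>1, and let v,w be non-negative measurable weights on (0,∞) with v^{p'} and w^q locally integrable; set r=pq/(p−q). If q≠1, then the Stieltjes-type operator S is compact from L^p to L^q if and only if B_H+B_{H*}<∞, where B_H=(∫_0^∞ (∫_0^t v^{p'})^{r/p'} (∫_t^∞ x^{−λq} w(x)^q dx)^{r/p} t^{−λq} w(t)^q dt)^{1/r} and B_{H*}=(∫_0^∞ (∫_t^∞ y^{−λp'} v(y)^{p'} dy)^{r/p'} (∫_0^t w^q)^{r/p} w(t)^q dt)^{1/r}. If q=1, then S is compact from L^p to L^1 if and only if Λ=(∫_0^∞ (∫_0^∞ w(x)/(x^λ+y^λ) dx)^{p'} v(y)^{p'} dy)^{1/p'} < ∞. -/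

import Mathlib

open MeasureTheory Set Filter Topology
open scoped ENNReal NNReal

noncomputable section

/-- The Stieltjes-type operator `Sf(x) = w(x) ∫_0^∞ f(y) v(y)/(x^λ + y^λ) dy`. -/
def SOp (lam : ℝ) (v w f : ℝ → ℝ) : ℝ → ℝ :=
  fun x => w x * ∫ y in Ioi (0:ℝ), f y * v y / (x ^ lam + y ^ lam)

/-- `(∫_0^∞ |g|^r)^{1/r}`, the `L^r(0,∞)` (quasi-)norm. -/
def eN (r : ℝ) (g : ℝ → ℝ) : ℝ≥0∞ :=
  (∫⁻ x in Ioi (0:ℝ), ENNReal.ofReal |g x| ^ r) ^ (1/r)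

/-- `V₀(t) = ∫_0^t v^{p'}`. -/
def V0 (p' : ℝ) (v : ℝ → ℝ) (t : ℝ) : ℝ≥0∞ :=
  ∫⁻ y in Ioo (0:ℝ) t, ENNReal.ofReal (v y) ^ p'

/-- `𝒱_t(∞) = ∫_t^∞ y^{-λp'} v(y)^{p'} dy`. -/
def Vinf (lam p' : ℝ) (v : ℝ → ℝ) (t : ℝ) : ℝ≥0∞ :=
  ∫⁻ y in Ioi t, (ENNReal.ofReal y) ^ (-(lam * p')) * ENNReal.ofReal (v y) ^ p'

/-- `W₀(t) = ∫_0^t w^q`. -/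
def W0 (q : ℝ) (w : ℝ → ℝ) (t : ℝ) : ℝ≥0∞ :=
  ∫⁻ x in Ioo (0:ℝ) t, ENNReal.ofReal (w x) ^ q

/-- `𝒲_t(∞) = ∫_t^∞ x^{-λq} w(x)^q dx`. -/
def Winf (lam q : ℝ) (w : ℝ → ℝ) (t : ℝ) : ℝ≥0∞ :=
  ∫⁻ x in Ioi t, (ENNReal.ofReal x) ^ (-(lam * q)) * ENNReal.ofReal (w x) ^ q


/-- Distance to `0` in `L^q`: the norm `(∫_0^∞|g|^q)^{1/q}` when `q ≥ 1`, and the metric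
`∫_0^∞|g|^q` of the complete metric space `L^q` when `0 < q < 1`. -/
def dS (q : ℝ) (g : ℝ → ℝ) : ℝ≥0∞ :=
  if 1 ≤ q then (∫⁻ x in Ioi (0:ℝ), ENNReal.ofReal |g x| ^ q) ^ (1/q)
  else ∫⁻ x in Ioi (0:ℝ), ENNReal.ofReal |g x| ^ q

/-- Compactness of the Stieltjes-type operator from `L^p` to `L^q`: every sequence of the
closed unit ball of `L^p` admits a subsequence whose image is Cauchy (equivalently,
convergent) in the complete space `L^q`. -/
def SCompact (lam p q : ℝ) (v w : ℝ → ℝ) : Prop :=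
  ∀ f : ℕ → ℝ → ℝ, (∀ n, Measurable (f n)) → (∀ n, eN p (f n) ≤ 1) →
    ∃ φ : ℕ → ℕ, StrictMono φ ∧
      ∀ ε : ℝ, 0 < ε → ∃ N : ℕ, ∀ m, N ≤ m → ∀ n, N ≤ n →
        dS q (fun x => SOp lam v w (f (φ m)) x - SOp lam v w (f (φ n)) x) < ENNReal.ofReal ε

/-! ### Powers of distribution functions of atomless measures -/

/-- A finite atomless measure gives mass `c` to the sublevel set `{ν (-∞, t) ≤ c}`. -/
lemma measure_setOf_measure_Iio_le (ν : Measure ℝ) [IsFiniteMeasure ν] [NullSingletonClass ν]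
    {c : ℝ≥0∞} (hc : c ≤ ν univ) : ν {t | ν (Iio t) ≤ c} = c := by
  have hI : ∀ t, ν (Iio t) = ν (Iic t) := fun t => measure_congr Iio_ae_eq_Iic
  set A : Set ℝ := {t | ν (Iio t) ≤ c} with hA
  have hlow : ∀ a b, a ≤ b → b ∈ A → a ∈ A := fun a b hab hb =>
    (measure_mono (Iio_subset_Iio hab)).trans hb
  rcases A.eq_empty_or_nonempty with h0 | hne
  · have h1 : Tendsto (fun n : ℕ => ν (Iic (-(n : ℝ)))) atTop (𝓝 (ν (⋂ n : ℕ, Iic (-(n : ℝ))))) := by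
      refine tendsto_measure_iInter_atTop (fun n => measurableSet_Iic.nullMeasurableSet) ?_
        ⟨0, measure_ne_top _ _⟩
      intro m n hmn
      exact Iic_subset_Iic.2 (by simpa using hmn)
    have h2 : (⋂ n : ℕ, Iic (-(n : ℝ))) = ∅ := by
      ext x
      simp only [mem_iInter, mem_Iic, mem_empty_iff_false, iff_false, not_forall, not_le]
      obtain ⟨n, hn⟩ := exists_nat_gt (-x)
      exact ⟨n, by linarith⟩
    rw [h2, measure_empty] at h1
    have h3 : c ≤ 0 := ge_of_tendsto' h1 fun n => by
      by_contra! hlt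
      have : (-(n : ℝ)) ∈ A := by
        rw [hA, mem_ofPred_eq, hI]; exact hlt.le
      simp [h0] at this
    rw [h0, measure_empty]
    exact (le_antisymm h3 bot_le).symm
  by_cases hb : BddAbove A
  · set s := sSup A
    have h1 : Iio s ⊆ A := fun x hx => by
      obtain ⟨b, hbA, hxb⟩ := exists_lt_of_lt_csSup hne hx
      exact hlow _ _ hxb.le hbA
    have h2 : A ⊆ Iic s := fun x hx => le_csSup hb hx
    have h3 : ν A = ν (Iio s) :=
      le_antisymm ((measure_mono h2).trans (hI s).ge) (measure_mono h1)
    rw [h3]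
    apply le_antisymm
    · obtain ⟨a, hmono, ha, hat⟩ := exists_seq_strictMono_tendsto s
      have h4 : Tendsto (fun n => ν (Iic (a n))) atTop (𝓝 (ν (⋃ n, Iic (a n)))) := by
        exact tendsto_measure_iUnion_atTop fun m n hmn => Iic_subset_Iic.2 (hmono.monotone hmn)
      rw [iUnion_Iic_eq_Iio_of_lt_of_tendsto ha hat] at h4
      refine le_of_tendsto' h4 fun n => ?_
      rw [← hI]
      exact h1 (ha n)
    · rw [hI]
      obtain ⟨a, hanti, ha, hat⟩ := exists_seq_strictAnti_tendsto s
      have h4 : Tendsto (fun n => ν (Iic (a n))) atTop (𝓝 (ν (⋂ n, Iic (a n)))) := by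
        refine tendsto_measure_iInter_atTop (fun n => measurableSet_Iic.nullMeasurableSet) ?_
          ⟨0, measure_ne_top _ _⟩
        exact fun m n hmn => Iic_subset_Iic.2 (hanti.antitone hmn)
      have h5 : (⋂ n, Iic (a n)) = Iic s := by
        ext x
        simp only [mem_iInter, mem_Iic]
        exact ⟨fun h => ge_of_tendsto' hat h, fun h n => h.trans (ha n).le⟩
      rw [h5] at h4
      refine ge_of_tendsto' h4 fun n => ?_
      by_contra! hlt
      have : a n ∈ A := by
        rw [hA, mem_ofPred_eq, hI]; exact hlt.le
      exact absurd (h2 this) (not_le.2 (ha n))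
  · have hu : A = univ := by
      ext x
      simp only [mem_univ, iff_true]
      rw [not_bddAbove_iff] at hb
      obtain ⟨y, hy, hxy⟩ := hb x
      exact hlow _ _ hxy.le hy
    rw [hu]
    refine le_antisymm (le_of_tendsto' (tendsto_measure_Iic_atTop ν) fun x => ?_) hc
    rw [← hI]
    have : x ∈ A := hu ▸ mem_univ x
    exact this

lemma measurable_measure_Iio (ν : Measure ℝ) : Measurable fun t => ν (Iio t) :=
  Monotone.measurable fun _ _ h => measure_mono (Iio_subset_Iio h)

lemma measurable_measure_Ioi (ν : Measure ℝ) : Measurable fun t => ν (Ioi t) :=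
  Antitone.measurable fun _ _ h => measure_mono (Ioi_subset_Ioi h)

/-- The distribution function of a finite atomless measure transports it to Lebesgue measure. -/
lemma map_measure_Iio (ν : Measure ℝ) [IsFiniteMeasure ν] [NullSingletonClass ν] :
    ν.map (fun t => (ν (Iio t)).toReal) = volume.restrict (Ioc 0 (ν univ).toReal) := by
  have hm : Measurable fun t => (ν (Iio t)).toReal := (measurable_measure_Iio ν).ennreal_toReal
  refine Measure.ext_of_Iic _ _ fun a => ?_
  rw [Measure.map_apply hm measurableSet_Iic, Measure.restrict_apply measurableSet_Iic]
  rcases lt_or_ge a 0 with ha | ha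
  · have h1 : (fun t => (ν (Iio t)).toReal) ⁻¹' Iic a = ∅ := by
      ext t
      simp only [mem_preimage, mem_Iic, mem_empty_iff_false, iff_false, not_le]
      exact ha.trans_le ENNReal.toReal_nonneg
    have h2 : Iic a ∩ Ioc 0 (ν univ).toReal = ∅ := by
      ext t
      simp only [mem_inter_iff, mem_Iic, mem_Ioc, mem_empty_iff_false, iff_false]
      rintro ⟨h, h', -⟩
      linarith
    rw [h1, h2]; simp
  · have h1 : (fun t => (ν (Iio t)).toReal) ⁻¹' Iic a = {t | ν (Iio t) ≤ ENNReal.ofReal a} := by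
      ext t
      simp only [mem_preimage, mem_Iic, mem_ofPred_eq]
      rw [ENNReal.le_ofReal_iff_toReal_le (measure_ne_top _ _) ha]
    have h2 : Iic a ∩ Ioc 0 (ν univ).toReal = Ioc 0 (min a (ν univ).toReal) := by
      ext t
      simp only [mem_inter_iff, mem_Iic, mem_Ioc, le_min_iff]
      tauto
    rw [h1, h2, Real.volume_Ioc, sub_zero]
    rcases le_total (ENNReal.ofReal a) (ν univ) with h | h
    · rw [measure_setOf_measure_Iio_le ν h, min_eq_left]
      exact (ENNReal.ofReal_le_iff_le_toReal (measure_ne_top _ _)).1 h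
    · have : {t | ν (Iio t) ≤ ENNReal.ofReal a} = univ := by
        ext t
        simp only [mem_ofPred_eq, mem_univ, iff_true]
        exact (measure_mono (subset_univ _)).trans h
      rw [this, min_eq_right, ENNReal.ofReal_toReal (measure_ne_top _ _)]
      exact (ENNReal.le_ofReal_iff_toReal_le (measure_ne_top _ _) ha).1 h

lemma lintegral_measure_Iio_rpow (ν : Measure ℝ) [IsFiniteMeasure ν] [NullSingletonClass ν]
    {a : ℝ} (ha : -1 < a) :
    ∫⁻ t, ν (Iio t) ^ a ∂ν = ν univ ^ (a + 1) / ENNReal.ofReal (a + 1) := by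
  have hm : Measurable fun t => (ν (Iio t)).toReal := (measurable_measure_Iio ν).ennreal_toReal
  have h1 : ∫⁻ t, ν (Iio t) ^ a ∂ν
      = ∫⁻ s, ENNReal.ofReal s ^ a ∂(ν.map (fun t => (ν (Iio t)).toReal)) := by
    rw [lintegral_map (by fun_prop) hm]
    refine lintegral_congr fun t => ?_
    rw [ENNReal.ofReal_toReal (measure_ne_top _ _)]
  have ha1 : 0 < a + 1 := by linarith
  set m := (ν univ).toReal with hmdef
  have hm0 : 0 ≤ m := ENNReal.toReal_nonneg
  have h2 : ∫⁻ s in Ioc 0 m, ENNReal.ofReal s ^ a = ∫⁻ s in Ioc 0 m, ENNReal.ofReal (s ^ a) :=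
    setLIntegral_congr_fun measurableSet_Ioc fun s hs => ENNReal.ofReal_rpow_of_pos hs.1
  have hint : IntegrableOn (fun s : ℝ => s ^ a) (Ioc 0 m) :=
    (intervalIntegrable_iff_integrableOn_Ioc_of_le hm0).1
      (intervalIntegral.intervalIntegrable_rpow' ha)
  rw [h1, map_measure_Iio, h2, ← ofReal_integral_eq_lintegral_ofReal hint
    ((ae_restrict_iff' measurableSet_Ioc).2 (.of_forall fun s hs => Real.rpow_nonneg hs.1.le _)),
    ← intervalIntegral.integral_of_le hm0, integral_rpow (.inl ha), Real.zero_rpow ha1.ne', sub_zero,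
    ENNReal.ofReal_div_of_pos ha1, ← ENNReal.ofReal_rpow_of_nonneg hm0 ha1.le, hmdef,
    ENNReal.ofReal_toReal (measure_ne_top _ _)]

lemma lintegral_measure_Ioi_rpow (ν : Measure ℝ) [IsFiniteMeasure ν] [NullSingletonClass ν]
    {a : ℝ} (ha : -1 < a) :
    ∫⁻ t, ν (Ioi t) ^ a ∂ν = ν univ ^ (a + 1) / ENNReal.ofReal (a + 1) := by
  have hI : ∀ t, (ν.map Neg.neg) (Iio t) = ν (Ioi (-t)) := fun t => by
    rw [Measure.map_apply measurable_neg measurableSet_Iio]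
    congr 1
    ext x
    simp
  have : NullSingletonClass (ν.map Neg.neg) := ⟨fun x => by
    rw [Measure.map_apply measurable_neg (measurableSet_singleton x)]
    have : (Neg.neg ⁻¹' {x} : Set ℝ) = {-x} := by
      ext y
      simp
    rw [this, measure_singleton]⟩
  have h := lintegral_measure_Iio_rpow (ν.map Neg.neg) ha
  rw [Measure.map_apply measurable_neg MeasurableSet.univ, preimage_univ,
    lintegral_map ((measurable_measure_Iio _).pow_const a) measurable_neg] at h
  simpa [hI] using h

/-- `∫_{(-∞,x)} V^a dV = V(x)^{a+1} / (a+1)` for `V(t) = ν (-∞, t)`. -/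
lemma setLIntegral_measure_Iio_rpow (ν : Measure ℝ) [IsFiniteMeasure ν] [NullSingletonClass ν]
    {a : ℝ} (ha : -1 < a) (x : ℝ) :
    ∫⁻ t in Iio x, ν (Iio t) ^ a ∂ν = ν (Iio x) ^ (a + 1) / ENNReal.ofReal (a + 1) := by
  have h := lintegral_measure_Iio_rpow (ν.restrict (Iio x)) ha
  rw [Measure.restrict_apply_univ] at h
  rw [← h]
  refine setLIntegral_congr_fun measurableSet_Iio fun t ht => ?_
  rw [Measure.restrict_apply measurableSet_Iio,
    inter_eq_left.2 (Iio_subset_Iio (le_of_lt ht))]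

/-- `∫_{(x,∞)} W^a d(-W) = W(x)^{a+1} / (a+1)` for `W(t) = ν (t, ∞)`. -/
lemma setLIntegral_measure_Ioi_rpow (ν : Measure ℝ) [IsFiniteMeasure ν] [NullSingletonClass ν]
    {a : ℝ} (ha : -1 < a) (x : ℝ) :
    ∫⁻ t in Ioi x, ν (Ioi t) ^ a ∂ν = ν (Ioi x) ^ (a + 1) / ENNReal.ofReal (a + 1) := by
  have h := lintegral_measure_Ioi_rpow (ν.restrict (Ioi x)) ha
  rw [Measure.restrict_apply_univ] at h
  rw [← h]
  refine setLIntegral_congr_fun measurableSet_Ioi fun t ht => ?_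
  rw [Measure.restrict_apply measurableSet_Ioi,
    inter_eq_left.2 (Ioi_subset_Ioi (le_of_lt ht))]

/-! ### The weighted Hardy inequality for `q < p` -/

lemma ENNReal.tsum_mul_le_Lp_mul_Lq {ι : Type*} [Countable ι] {a b : ℝ}
    (hab : a.HolderConjugate b) (F G : ι → ℝ≥0∞) :
    ∑' i, F i * G i ≤ (∑' i, F i ^ a) ^ (1 / a) * (∑' i, G i ^ b) ^ (1 / b) := by
  let _ : MeasurableSpace ι := ⊤
  have h := ENNReal.lintegral_mul_le_Lp_mul_Lq (Measure.count : Measure ι) hab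
    (f := F) (g := G) (measurable_from_top.aemeasurable) (measurable_from_top.aemeasurable)
  simpa [lintegral_count] using h

lemma hardy_le_of_finite (μ η : Measure ℝ) [NullSingletonClass μ] [IsFiniteMeasure η]
    [NullSingletonClass η] {p p' q r : ℝ} (hp : p.HolderConjugate p') (hq : 0 < q) (hr : 0 < r)
    (hpqr : r / p + 1 = r / q) {f g : ℝ → ℝ≥0∞} (hf : Measurable f) (hg : Measurable g)
    (hfg : ∫⁻ y, f y * g y ∂μ ≠ ∞) :
    ∫⁻ x, (∫⁻ y in Iio x, f y * g y ∂μ) ^ q ∂η ≤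
      4 ^ q * ENNReal.ofReal (r / q) ^ (q / r) *
        ((∫⁻ t, (∫⁻ y in Iio t, g y ^ p' ∂μ) ^ (r / p') * η (Ioi t) ^ (r / p) ∂η) ^ (q / r) *
          (∫⁻ y, f y ^ p ∂μ) ^ (q / p)) := by
  have hp0 : 0 < p := hp.pos
  have hp'0 : 0 < p' := hp.symm.pos
  have hrq : 0 < r / q := div_pos hr hq
  have hconj : (p / q).HolderConjugate (r / q) := by
    rw [Real.holderConjugate_iff]
    constructor
    · have : r / p < r / q := by linarith
      rw [lt_div_iff₀ hq, one_mul]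
      exact (div_lt_div_iff_of_pos_left hr hp0 hq).1 this
    · rw [← hpqr]
      have h : q * (r + p) = r * p := by
        field_simp at hpqr
        linarith
      field_simp
      linarith
  set κ : Measure ℝ := μ.withDensity (fun y => f y * g y) with hκ
  have hκf : IsFiniteMeasure κ := isFiniteMeasure_withDensity hfg
  have hκI : ∀ s, MeasurableSet s → κ s = ∫⁻ y in s, f y * g y ∂μ := fun s hs =>
    withDensity_apply _ hs
  set F : ℝ → ℝ≥0∞ := fun x => κ (Iio x) with hF
  have hFm : Measurable F := measurable_measure_Iio κ
  have hFfin : ∀ x, F x ≠ ∞ := fun x => measure_ne_top _ _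
  set E : ℤ → Set ℝ := fun k => F ⁻¹' Ioc (2 ^ k) (2 ^ (k + 1)) with hE
  have hEm : ∀ k, MeasurableSet (E k) := fun k => hFm measurableSet_Ioc
  have hmono2 : ∀ {a b : ℤ}, a ≤ b → (2 : ℝ≥0∞) ^ a ≤ 2 ^ b := fun h =>
    ENNReal.zpow_le_of_le (by norm_num) h
  have hEdisj : Pairwise (Function.onFun Disjoint E) := by
    have key : ∀ a b : ℤ, a < b → Disjoint (E a) (E b) := fun a b hab => by
      rw [Set.disjoint_left]
      intro x hxa hxb
      have h1 : F x ≤ 2 ^ (a + 1) := hxa.2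
      have h2 : 2 ^ b < F x := hxb.1
      exact absurd (h1.trans (hmono2 (by lia : a + 1 ≤ b))) (not_le.2 h2)
    intro a b hab
    rcases lt_or_gt_of_ne hab with h | h
    · exact key a b h
    · exact (key b a h).symm
  have hEF : ∀ k, (E k).Nonempty → κ (E (k - 1)) = 2 ^ (k - 1) := by
    rintro k ⟨x, hx⟩
    have hle : (2 : ℝ≥0∞) ^ k ≤ κ univ :=
      (le_of_lt hx.1).trans (measure_mono (subset_univ _))
    have hE' : E (k - 1) = {t | F t ≤ 2 ^ k} \ {t | F t ≤ 2 ^ (k - 1)} := by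
      ext t
      simp only [hE, mem_preimage, mem_Ioc, Set.mem_sdiff, mem_ofPred_eq, not_le, sub_add_cancel]
      exact and_comm
    have hsub : {t | F t ≤ 2 ^ (k - 1)} ⊆ {t | F t ≤ 2 ^ k} := fun t ht =>
      le_trans ht (hmono2 (by lia))
    rw [hE', measure_sdiff hsub
      (hFm measurableSet_Iic).nullMeasurableSet (measure_ne_top _ _),
      measure_setOf_measure_Iio_le κ hle,
      measure_setOf_measure_Iio_le κ ((hmono2 (by lia)).trans hle)]
    have : (2 : ℝ≥0∞) ^ k = 2 ^ (k - 1) + 2 ^ (k - 1) := by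
      rw [← two_mul]
      conv_lhs => rw [show k = 1 + (k - 1) by ring, ENNReal.zpow_add (by norm_num) (by norm_num)]
      simp
    rw [this, ENNReal.add_sub_cancel_right]
    exact (ENNReal.zpow_lt_top (by norm_num) (by norm_num) _).ne
  set a : ℤ → ℝ≥0∞ := fun k => ∫⁻ y in E (k - 1), f y ^ p ∂μ with ha
  set G : ℤ → ℝ≥0∞ := fun k => ∫⁻ y in E (k - 1), g y ^ p' ∂μ with hG
  have hshift : ∀ x k, x ∈ E k → E (k - 1) ⊆ Iio x := by
    intro x k hx y hy
    by_contra! hxy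
    have h1 : F x ≤ F y := measure_mono (Iio_subset_Iio (not_lt.1 hxy))
    have h2 : F y ≤ 2 ^ k := by simpa using hy.2
    exact absurd (h1.trans h2) (not_le.2 hx.1)
  have hlevel : ∀ k, (2 ^ (k + 1)) ^ q * η (E k) ≤
      4 ^ q * (a k ^ (q / p) * (G k ^ (q / p') * η (E k))) := by
    intro k
    rcases (E k).eq_empty_or_nonempty with h0 | hne
    · simp [h0]
    have h1 : (2 : ℝ≥0∞) ^ (k + 1) ≤ 4 * (a k ^ (1 / p) * G k ^ (1 / p')) := by
      have h2 := hEF k hne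
      rw [hκI _ (hEm _)] at h2
      have h3 : (2 : ℝ≥0∞) ^ (k + 1) = 4 * 2 ^ (k - 1) := by
        rw [show k + 1 = 2 + (k - 1) by ring, ENNReal.zpow_add (by norm_num) (by norm_num)]
        norm_num
      rw [h3, ← h2]
      gcongr
      exact ENNReal.lintegral_mul_le_Lp_mul_Lq _ hp hf.aemeasurable hg.aemeasurable
    calc (2 ^ (k + 1)) ^ q * η (E k) ≤ (4 * (a k ^ (1 / p) * G k ^ (1 / p'))) ^ q * η (E k) := by
          gcongr
      _ = _ := by
          rw [ENNReal.mul_rpow_of_nonneg _ _ hq.le, ENNReal.mul_rpow_of_nonneg _ _ hq.le,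
            ← ENNReal.rpow_mul, ← ENNReal.rpow_mul, one_div_mul_eq_div, one_div_mul_eq_div]
          ring
  have hcover : ∫⁻ x, F x ^ q ∂η ≤ ∑' k, (2 ^ (k + 1)) ^ q * η (E k) := by
    have h1 : ∀ x, F x ^ q ≤ (⋃ k, E k).indicator (fun x => F x ^ q) x := fun x => by
      by_cases hx : F x = 0
      · simp [hx, hq]
      · obtain ⟨k, hk⟩ := ENNReal.exists_mem_Ioc_zpow hx (hFfin x) (y := 2) (by norm_num) (by norm_num)
        rw [indicator_of_mem (mem_iUnion.2 ⟨k, hk⟩)]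
    calc ∫⁻ x, F x ^ q ∂η ≤ ∫⁻ x in ⋃ k, E k, F x ^ q ∂η := by
          rw [← lintegral_indicator (MeasurableSet.iUnion hEm)]
          exact lintegral_mono h1
      _ ≤ ∑' k, ∫⁻ x in E k, F x ^ q ∂η := lintegral_iUnion_le _ _
      _ ≤ _ := by
          refine ENNReal.tsum_le_tsum fun k => ?_
          rw [← setLIntegral_const]
          refine setLIntegral_mono measurable_const fun x hx => ?_
          have : F x ≤ 2 ^ (k + 1) := hx.2
          gcongr
  have hholder := ENNReal.tsum_mul_le_Lp_mul_Lq hconj (fun k => a k ^ (q / p))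
    (fun k => G k ^ (q / p') * η (E k))
  have hA : ∑' k, (a k ^ (q / p)) ^ (p / q) ≤ ∫⁻ y, f y ^ p ∂μ := by
    have : ∀ k, (a k ^ (q / p)) ^ (p / q) = a k := fun k => by
      rw [← ENNReal.rpow_mul, show q / p * (p / q) = 1 by field_simp, ENNReal.rpow_one]
    simp_rw [this, ha]
    rw [show ∑' k : ℤ, ∫⁻ y in E (k - 1), f y ^ p ∂μ = ∑' k, ∫⁻ y in E k, f y ^ p ∂μ from
      (Equiv.subRight (1 : ℤ)).tsum_eq (fun k => ∫⁻ y in E k, f y ^ p ∂μ), ← lintegral_iUnion hEm hEdisj]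
    exact setLIntegral_le_lintegral _ _
  have hB : ∑' k, (G k ^ (q / p') * η (E k)) ^ (r / q) ≤ ENNReal.ofReal (r / q) *
      ∫⁻ t, (∫⁻ y in Iio t, g y ^ p' ∂μ) ^ (r / p') * η (Ioi t) ^ (r / p) ∂η := by
    have h1 : ∀ k, (G k ^ (q / p') * η (E k)) ^ (r / q) ≤ ENNReal.ofReal (r / q) *
        ∫⁻ t in E k, (∫⁻ y in Iio t, g y ^ p' ∂μ) ^ (r / p') * η (Ioi t) ^ (r / p) ∂η := by
      intro k
      have h2 := lintegral_measure_Ioi_rpow (η.restrict (E k)) (a := r / p)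
        (by have := div_pos hr hp0; linarith)
      rw [Measure.restrict_apply_univ, hpqr] at h2
      have h3 : η (E k) ^ (r / q) = ENNReal.ofReal (r / q) *
          ∫⁻ t in E k, (η.restrict (E k)) (Ioi t) ^ (r / p) ∂η := by
        rw [h2, ENNReal.mul_div_cancel (by simpa using hrq) ENNReal.ofReal_ne_top]
      rw [ENNReal.mul_rpow_of_nonneg _ _ hrq.le, ← ENNReal.rpow_mul,
        show q / p' * (r / q) = r / p' by field_simp, h3, mul_left_comm]
      gcongr
      rw [← lintegral_const_mul _ ((measurable_measure_Ioi _).pow_const _)]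
      refine setLIntegral_mono' (hEm k) fun t ht => ?_
      gcongr
      · exact lintegral_mono_set (hshift t k ht)
      · exact Measure.restrict_le_self
    calc _ ≤ _ := ENNReal.tsum_le_tsum h1
      _ = ENNReal.ofReal (r / q) * ∫⁻ t in ⋃ k, E k,
          (∫⁻ y in Iio t, g y ^ p' ∂μ) ^ (r / p') * η (Ioi t) ^ (r / p) ∂η := by
        rw [ENNReal.tsum_mul_left, lintegral_iUnion hEm hEdisj]
      _ ≤ _ := by
        gcongr
        exact Measure.restrict_le_self
  have hFeq : ∀ x, ∫⁻ y in Iio x, f y * g y ∂μ = F x := fun x => (hκI _ measurableSet_Iio).symm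
  simp_rw [hFeq]
  calc ∫⁻ x, F x ^ q ∂η ≤ ∑' k, 4 ^ q * (a k ^ (q / p) * (G k ^ (q / p') * η (E k))) :=
        hcover.trans (ENNReal.tsum_le_tsum hlevel)
    _ ≤ 4 ^ q * ((∫⁻ y, f y ^ p ∂μ) ^ (1 / (p / q)) * (ENNReal.ofReal (r / q) *
      ∫⁻ t, (∫⁻ y in Iio t, g y ^ p' ∂μ) ^ (r / p') * η (Ioi t) ^ (r / p) ∂η) ^ (1 / (r / q))) := by
        rw [ENNReal.tsum_mul_left]
        gcongr
        refine hholder.trans ?_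
        gcongr
    _ = _ := by
        rw [one_div_div, one_div_div, ENNReal.mul_rpow_of_nonneg _ _ (div_pos hq hr).le]
        ring

/-- The test function argument: a Hardy inequality forces the integral condition on the weights. -/
lemma lintegral_le_of_hardy_of_finite (μ η : Measure ℝ) [NullSingletonClass μ]
    [IsFiniteMeasure η] [NullSingletonClass η] {p p' q r : ℝ} (hp : p.HolderConjugate p')
    (hq : 0 < q) (hr : 0 < r) (hpqr : r / p + 1 = r / q) {g : ℝ → ℝ≥0∞} (hg : Measurable g)
    (hgfin : ∫⁻ y, g y ^ p' ∂μ ≠ ∞) {K : ℝ≥0∞}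
    (hK : ∀ f : ℝ → ℝ≥0∞, Measurable f →
      ∫⁻ x, (∫⁻ y in Iio x, f y * g y ∂μ) ^ q ∂η ≤ K * (∫⁻ y, f y ^ p ∂μ) ^ (q / p)) :
    ∫⁻ t, (∫⁻ y in Iio t, g y ^ p' ∂μ) ^ (r / p') * η (Ioi t) ^ (r / p) ∂η ≤
      (ENNReal.ofReal (r / (p' * q)) ^ q *
        (K * (ENNReal.ofReal (r / q) / ENNReal.ofReal (r / p')) ^ (q / p))) ^ (r / q) := by
  have hp0 : 0 < p := hp.pos
  have hp'0 : 0 < p' := hp.symm.pos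
  have hinv : 1 / p + 1 / p' = 1 := by simpa using hp.inv_add_inv_eq_one
  have hrq : 0 < r / q := div_pos hr hq
  have hrp' : 0 < r / p' := div_pos hr hp'0
  have hrpq : 0 < r / (p' * q) := by positivity
  set ν : Measure ℝ := μ.withDensity (fun y => g y ^ p') with hν
  have hgp : Measurable fun y => g y ^ p' := hg.pow_const _
  have hνf : IsFiniteMeasure ν := isFiniteMeasure_withDensity hgfin
  have hVeq : ∀ t, ∫⁻ y in Iio t, g y ^ p' ∂μ = ν (Iio t) := fun t =>
    (withDensity_apply _ measurableSet_Iio).symm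
  simp_rw [hVeq]
  set V : ℝ → ℝ≥0∞ := fun t => ν (Iio t) with hV
  set W : ℝ → ℝ≥0∞ := fun t => η (Ioi t) with hW
  have hVm : Measurable V := measurable_measure_Iio ν
  have hWm : Measurable W := measurable_measure_Ioi η
  set b : ℝ≥0∞ := ∫⁻ t, V t ^ (r / p') * W t ^ (r / p) ∂η with hb
  have hbfin : b ≠ ∞ := by
    have h1 : b ≤ ∫⁻ _, ν univ ^ (r / p') * η univ ^ (r / p) ∂η := by
      refine lintegral_mono fun t => ?_
      gcongr
      · exact measure_mono (subset_univ _)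
      · exact measure_mono (subset_univ _)
    refine ne_top_of_le_ne_top ?_ h1
    rw [lintegral_const]
    exact ENNReal.mul_ne_top (ENNReal.mul_ne_top
      (ENNReal.rpow_ne_top_of_nonneg hrp'.le (measure_ne_top _ _))
      (ENNReal.rpow_ne_top_of_nonneg (div_pos hr hp0).le (measure_ne_top _ _))) (measure_ne_top _ _)
  set α := r / (p * q) with hα
  set β := (r / p' - 1) / p with hβ
  have hα0 : 0 < α := by positivity
  have hβ1 : β + 1 = r / (p' * q) := by
    have h1 : r / (p' * q) = (1 / p') * (r / p + 1) := by rw [hpqr]; field_simp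
    rw [h1, hβ, show 1 / p' = 1 - 1 / p by linarith, show r / p' = r * (1 - 1 / p) by
      rw [show 1 - 1 / p = 1 / p' by linarith]; ring]
    ring
  set Z : Set ℝ := {t | V t ≤ 0} with hZ
  have hZm : MeasurableSet Z := hVm measurableSet_Iic
  have hZν : ν Z = 0 := measure_setOf_measure_Iio_le ν bot_le
  set f : ℝ → ℝ≥0∞ := Zᶜ.indicator (fun y => W y ^ α * V y ^ β * g y ^ (p' - 1)) with hf
  have hfm : Measurable f := by
    refine Measurable.indicator ?_ hZm.compl
    fun_prop
  -- the norm of the test function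
  have hnorm : ∫⁻ y, f y ^ p ∂μ ≤ ENNReal.ofReal (r / q) / ENNReal.ofReal (r / p') * b := by
    have h1 : ∀ y, f y ^ p ≤ g y ^ p' * (W y ^ (r / q) * V y ^ (r / p' - 1)) := fun y => by
      by_cases hy : y ∈ Z
      · simp [hf, hy, hp0]
      · rw [hf, indicator_of_mem (show y ∈ Zᶜ from hy), ENNReal.mul_rpow_of_nonneg _ _ hp0.le,
          ENNReal.mul_rpow_of_nonneg _ _ hp0.le, ← ENNReal.rpow_mul, ← ENNReal.rpow_mul,
          ← ENNReal.rpow_mul, show α * p = r / q by rw [hα]; field_simp,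
          show β * p = r / p' - 1 by rw [hβ]; field_simp,
          show (p' - 1) * p = p' by rw [hp.symm.sub_one_mul_conj], mul_comm]
    have h2 : ∀ y, W y ^ (r / q) = ENNReal.ofReal (r / q) * ∫⁻ x in Ioi y, W x ^ (r / p) ∂η :=
      fun y => by
        rw [setLIntegral_measure_Ioi_rpow η (by have := div_pos hr hp0; linarith), hpqr,
          ENNReal.mul_div_cancel (by simpa using hrq) ENNReal.ofReal_ne_top]
    have h3 : ∀ x, ∫⁻ y in Iio x, V y ^ (r / p' - 1) ∂ν
        = V x ^ (r / p') / ENNReal.ofReal (r / p') := fun x => by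
      rw [setLIntegral_measure_Iio_rpow ν (by linarith), sub_add_cancel]
    have hmeas : Measurable (Function.uncurry fun y x : ℝ =>
        (Ioi y).indicator (fun x => V y ^ (r / p' - 1) * W x ^ (r / p)) x) := by
      have : (Function.uncurry fun y x : ℝ =>
          (Ioi y).indicator (fun x => V y ^ (r / p' - 1) * W x ^ (r / p)) x) =
          {z : ℝ × ℝ | z.1 < z.2}.indicator
            (fun z => V z.1 ^ (r / p' - 1) * W z.2 ^ (r / p)) := by
        ext ⟨y, x⟩
        simp [Function.uncurry, indicator]
      rw [this]
      refine Measurable.indicator ?_ (measurableSet_lt measurable_fst measurable_snd)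
      fun_prop
    calc ∫⁻ y, f y ^ p ∂μ ≤ ∫⁻ y, g y ^ p' * (W y ^ (r / q) * V y ^ (r / p' - 1)) ∂μ :=
          lintegral_mono h1
      _ = ∫⁻ y, W y ^ (r / q) * V y ^ (r / p' - 1) ∂ν := by
          rw [hν, lintegral_withDensity_eq_lintegral_mul _ hgp (by fun_prop)]
          rfl
      _ = ENNReal.ofReal (r / q) * ∫⁻ y, ∫⁻ x,
            (Ioi y).indicator (fun x => V y ^ (r / p' - 1) * W x ^ (r / p)) x ∂η ∂ν := by
          rw [← lintegral_const_mul _ hmeas.lintegral_prod_right]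
          refine lintegral_congr fun y => ?_
          rw [h2, lintegral_indicator measurableSet_Ioi,
            lintegral_const_mul _ (hWm.pow_const _)]
          ring
      _ = ENNReal.ofReal (r / q) * ∫⁻ x, ∫⁻ y,
            (Ioi y).indicator (fun x => V y ^ (r / p' - 1) * W x ^ (r / p)) x ∂ν ∂η := by
          rw [lintegral_lintegral_swap hmeas.aemeasurable]
      _ = ENNReal.ofReal (r / q) *
            ∫⁻ x, (ENNReal.ofReal (r / p'))⁻¹ * (V x ^ (r / p') * W x ^ (r / p)) ∂η := by
          congr 1
          refine lintegral_congr fun x => ?_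
          have h4 : ∀ y, (Ioi y).indicator (fun x => V y ^ (r / p' - 1) * W x ^ (r / p)) x =
              (Iio x).indicator (fun y => V y ^ (r / p' - 1) * W x ^ (r / p)) y := fun y => by
            simp [indicator]
          simp_rw [h4]
          rw [lintegral_indicator measurableSet_Iio, lintegral_mul_const _ (hVm.pow_const _), h3,
            div_eq_mul_inv]
          ring
      _ = _ := by
          rw [lintegral_const_mul _ (by fun_prop), ← mul_assoc, ← div_eq_mul_inv]
  -- the lower bound for the operator
  have hlow : ∀ x, W x ^ α * V x ^ (r / (p' * q)) ≤ ENNReal.ofReal (r / (p' * q)) *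
      ∫⁻ y in Iio x, f y * g y ∂μ := fun x => by
    have h1 : ∀ y, f y * g y = g y ^ p' * Zᶜ.indicator (fun y => W y ^ α * V y ^ β) y :=
      fun y => by
        by_cases hy : y ∈ Z
        · simp [hf, hy]
        · have h2 : g y ^ p' = g y ^ (p' - 1) * g y := by
            conv_rhs => rw [← ENNReal.rpow_one (g y), ← ENNReal.rpow_mul, one_mul,
              ← ENNReal.rpow_add_of_nonneg _ _ (by linarith [hp.symm.lt]) zero_le_one]
            rw [sub_add_cancel]
          rw [hf, indicator_of_mem (show y ∈ Zᶜ from hy), indicator_of_mem (show y ∈ Zᶜ from hy),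
            h2]
          ring
    have h3 : ∫⁻ y in Iio x, f y * g y ∂μ = ∫⁻ y in Iio x, W y ^ α * V y ^ β ∂ν := by
      simp_rw [h1]
      have h4 : ∫⁻ y in Iio x, Zᶜ.indicator (fun y => W y ^ α * V y ^ β) y ∂ν =
          ∫⁻ y in Iio x, W y ^ α * V y ^ β ∂ν := by
        refine lintegral_congr_ae (ae_restrict_of_ae ?_)
        have : ∀ᵐ y ∂ν, y ∈ Zᶜ := measure_eq_zero_iff_ae_notMem.1 hZν
        filter_upwards [this] with y hy
        rw [indicator_of_mem hy]
      rw [← h4, hν, restrict_withDensity measurableSet_Iio,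
        lintegral_withDensity_eq_lintegral_mul _ hgp
          (Measurable.indicator (by fun_prop) hZm.compl)]
      rfl
    have h5 : W x ^ α * ∫⁻ y in Iio x, V y ^ β ∂ν ≤ ∫⁻ y in Iio x, W y ^ α * V y ^ β ∂ν := by
      rw [← lintegral_const_mul _ (hVm.pow_const _)]
      refine setLIntegral_mono' measurableSet_Iio fun y hy => ?_
      gcongr
      exact measure_mono (Ioi_subset_Ioi (le_of_lt hy))
    rw [setLIntegral_measure_Iio_rpow ν (by linarith), hβ1] at h5
    rw [h3]
    calc W x ^ α * V x ^ (r / (p' * q)) = ENNReal.ofReal (r / (p' * q)) *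
          (W x ^ α * (V x ^ (r / (p' * q)) / ENNReal.ofReal (r / (p' * q)))) := by
          rw [mul_left_comm,
            ENNReal.mul_div_cancel (by simpa using hrpq) ENNReal.ofReal_ne_top]
      _ ≤ _ := by gcongr
  have hmain : b ≤ ENNReal.ofReal (r / (p' * q)) ^ q *
      (K * (ENNReal.ofReal (r / q) / ENNReal.ofReal (r / p') * b) ^ (q / p)) := by
    calc b ≤ ∫⁻ x, ENNReal.ofReal (r / (p' * q)) ^ q * (∫⁻ y in Iio x, f y * g y ∂μ) ^ q ∂η := by
          refine lintegral_mono fun x => ?_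
          have h1 := ENNReal.rpow_le_rpow (hlow x) hq.le
          rw [ENNReal.mul_rpow_of_nonneg _ _ hq.le, ENNReal.mul_rpow_of_nonneg _ _ hq.le,
            ← ENNReal.rpow_mul, ← ENNReal.rpow_mul, show α * q = r / p by rw [hα]; field_simp,
            show r / (p' * q) * q = r / p' by field_simp] at h1
          rwa [mul_comm]
      _ = ENNReal.ofReal (r / (p' * q)) ^ q * ∫⁻ x, (∫⁻ y in Iio x, f y * g y ∂μ) ^ q ∂η := by
          refine lintegral_const_mul' _ _ ?_
          exact ENNReal.rpow_ne_top_of_nonneg hq.le ENNReal.ofReal_ne_top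
      _ ≤ _ := by
          gcongr
          refine (hK f hfm).trans ?_
          gcongr
  rcases eq_or_ne b 0 with hb0 | hb0
  · rw [hb0]; exact bot_le
  have hqr : q / r = 1 - q / p := by
    have h : r / p = r / q - 1 := by linarith
    field_simp at h ⊢
    linarith
  have hbq0 : b ^ (q / p) ≠ 0 := by
    simp [ENNReal.rpow_eq_zero_iff, hb0, hbfin]
  have hbqt : b ^ (q / p) ≠ ∞ := ENNReal.rpow_ne_top_of_nonneg (div_pos hq hp0).le hbfin
  have hfinal : b ^ (q / r) ≤ ENNReal.ofReal (r / (p' * q)) ^ q *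
        (K * (ENNReal.ofReal (r / q) / ENNReal.ofReal (r / p')) ^ (q / p)) := by
    rw [hqr, ENNReal.rpow_sub _ _ hb0 hbfin, ENNReal.rpow_one, ENNReal.div_le_iff hbq0 hbqt]
    refine hmain.trans_eq ?_
    rw [ENNReal.mul_rpow_of_nonneg _ _ (div_pos hq hp0).le]
    ring
  calc b = (b ^ (q / r)) ^ (r / q) := by
        rw [← ENNReal.rpow_mul, show q / r * (r / q) = 1 by field_simp, ENNReal.rpow_one]
    _ ≤ _ := ENNReal.rpow_le_rpow hfinal hrq.le

/-- The sequence `a` is monotone with supremum `l`. -/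
def IncreasesTo (a : ℕ → ℝ≥0∞) (l : ℝ≥0∞) : Prop := Monotone a ∧ ⨆ n, a n = l

namespace IncreasesTo

variable {a b : ℕ → ℝ≥0∞} {l m : ℝ≥0∞}

lemma le (h : IncreasesTo a l) (n : ℕ) : a n ≤ l := h.2 ▸ le_iSup a n

lemma limit_le (h : IncreasesTo a l) (hb : ∀ n, a n ≤ m) : l ≤ m := h.2 ▸ iSup_le hb

lemma const (l : ℝ≥0∞) : IncreasesTo (fun _ => l) l := ⟨monotone_const, by simp⟩

lemma mul (ha : IncreasesTo a l) (hb : IncreasesTo b m) :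
    IncreasesTo (fun n => a n * b n) (l * m) := by
  refine ⟨fun i j hij => mul_le_mul' (ha.1 hij) (hb.1 hij), le_antisymm
    (iSup_le fun n => mul_le_mul' (ha.le n) (hb.le n)) ?_⟩
  rw [← ha.2, ← hb.2, ENNReal.iSup_mul]
  refine iSup_le fun i => ?_
  rw [ENNReal.mul_iSup]
  refine iSup_le fun j => ?_
  exact (mul_le_mul' (ha.1 (le_max_left i j)) (hb.1 (le_max_right i j))).trans
    (le_iSup (fun n => a n * b n) (max i j))

lemma rpow (ha : IncreasesTo a l) {s : ℝ} (hs : 0 < s) :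
    IncreasesTo (fun n => a n ^ s) (l ^ s) := by
  refine ⟨fun i j hij => ENNReal.rpow_le_rpow (ha.1 hij) hs.le, ?_⟩
  rw [← ha.2]
  exact ((ENNReal.orderIsoRpow s hs).map_iSup a).symm

lemma lintegral {α : Type*} [MeasurableSpace α] {μ : Measure α} {F : ℕ → α → ℝ≥0∞}
    {G : α → ℝ≥0∞} (hF : ∀ n, Measurable (F n)) (h : ∀ x, IncreasesTo (fun n => F n x) (G x)) :
    IncreasesTo (fun n => ∫⁻ x, F n x ∂μ) (∫⁻ x, G x ∂μ) := by
  have hm : Monotone F := fun i j hij x => (h x).1 hij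
  refine ⟨fun i j hij => lintegral_mono (hm hij), ?_⟩
  rw [← lintegral_iSup hF hm]
  exact lintegral_congr fun x => (h x).2

end IncreasesTo

/-- Truncation in height and support. -/
def truncate (μ : Measure ℝ) [SigmaFinite μ] (f : ℝ → ℝ≥0∞) (n : ℕ) : ℝ → ℝ≥0∞ :=
  (spanningSets μ n).indicator fun x => min (f x) n

section truncate

variable (μ : Measure ℝ) [SigmaFinite μ] {f : ℝ → ℝ≥0∞}

lemma measurable_truncate (hf : Measurable f) (n : ℕ) : Measurable (truncate μ f n) :=
  (hf.min measurable_const).indicator (measurableSet_spanningSets μ n)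

lemma increasesTo_truncate (f : ℝ → ℝ≥0∞) (x : ℝ) :
    IncreasesTo (fun n => truncate μ f n x) (f x) := by
  have hmono : Monotone fun n => truncate μ f n x := by
    intro i j hij
    simp only [truncate, indicator]
    split_ifs with h1 h2
    · exact min_le_min le_rfl (by exact_mod_cast hij)
    · exact absurd (monotone_spanningSets μ hij h1) h2
    · exact bot_le
    · exact le_rfl
  refine ⟨hmono, le_antisymm (iSup_le fun n => ?_) ?_⟩
  · simp only [truncate, indicator]
    split_ifs
    · exact min_le_left _ _
    · exact bot_le
  · refine le_of_forall_lt fun c hc => ?_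
    obtain ⟨n, hn⟩ := ENNReal.exists_nat_gt (ne_top_of_lt hc)
    have hx : x ∈ ⋃ n, spanningSets μ n := by rw [iUnion_spanningSets]; trivial
    obtain ⟨m, hm⟩ := mem_iUnion.1 hx
    refine lt_of_lt_of_le ?_ (le_iSup (fun n => truncate μ f n x) (max m n))
    simp only [truncate]
    rw [indicator_of_mem (monotone_spanningSets μ (le_max_left m n) hm)]
    refine lt_min hc (hn.trans_le ?_)
    exact_mod_cast le_max_right m n

lemma truncate_le (f : ℝ → ℝ≥0∞) (n : ℕ) (x : ℝ) : truncate μ f n x ≤ f x :=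
  (increasesTo_truncate μ f x).le n

lemma lintegral_truncate_rpow_ne_top (f : ℝ → ℝ≥0∞) (n : ℕ) {s : ℝ} (hs : 0 < s) :
    ∫⁻ x, truncate μ f n x ^ s ∂μ ≠ ∞ := by
  have h : ∀ x, truncate μ f n x ^ s ≤
      (spanningSets μ n).indicator (fun _ => (n : ℝ≥0∞) ^ s) x := fun x => by
    simp only [truncate, indicator]
    split_ifs
    · gcongr
      exact min_le_right _ _
    · simp [hs]
  refine ne_top_of_le_ne_top ?_ (lintegral_mono h)
  rw [lintegral_indicator (measurableSet_spanningSets μ n), setLIntegral_const]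
  exact ENNReal.mul_ne_top (ENNReal.rpow_ne_top_of_nonneg hs.le (by simp))
    (measure_spanningSets_lt_top μ n).ne

end truncate

lemma measurable_setLIntegral_Iio (μ : Measure ℝ) (h : ℝ → ℝ≥0∞) :
    Measurable fun x => ∫⁻ y in Iio x, h y ∂μ :=
  Monotone.measurable fun _ _ hab => lintegral_mono_set (Iio_subset_Iio hab)

lemma measurable_setLIntegral_Ioi (μ : Measure ℝ) (h : ℝ → ℝ≥0∞) :
    Measurable fun x => ∫⁻ y in Ioi x, h y ∂μ :=
  Antitone.measurable fun _ _ hab => lintegral_mono_set (Ioi_subset_Ioi hab)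

/-- The `r`-th power of the constant in the weighted Hardy inequality, `q < p`. -/
def hardyConst (μ : Measure ℝ) (p p' r : ℝ) (g u : ℝ → ℝ≥0∞) : ℝ≥0∞ :=
  ∫⁻ t, (∫⁻ y in Iio t, g y ^ p' ∂μ) ^ (r / p') * (∫⁻ x in Ioi t, u x ∂μ) ^ (r / p) * u t ∂μ

theorem hardy_le (μ : Measure ℝ) [SigmaFinite μ] [NullSingletonClass μ] {p p' q r : ℝ}
    (hp : p.HolderConjugate p') (hq : 0 < q) (hr : 0 < r) (hpqr : r / p + 1 = r / q)
    {f g u : ℝ → ℝ≥0∞} (hf : Measurable f) (hg : Measurable g) (hu : Measurable u) :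
    ∫⁻ x, (∫⁻ y in Iio x, f y * g y ∂μ) ^ q * u x ∂μ ≤
      4 ^ q * ENNReal.ofReal (r / q) ^ (q / r) *
        (hardyConst μ p p' r g u ^ (q / r) * (∫⁻ y, f y ^ p ∂μ) ^ (q / p)) := by
  have hp0 : 0 < p := hp.pos
  have hp'0 : 0 < p' := hp.symm.pos
  have hfm := measurable_truncate μ hf
  have hgm := measurable_truncate μ hg
  have hum := measurable_truncate μ hu
  have hlim : IncreasesTo (fun n => ∫⁻ x, (∫⁻ y in Iio x, truncate μ f n y * truncate μ g n y ∂μ) ^ q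
      * truncate μ u n x ∂μ) (∫⁻ x, (∫⁻ y in Iio x, f y * g y ∂μ) ^ q * u x ∂μ) := by
    refine .lintegral (fun n => ((measurable_setLIntegral_Iio μ _).pow_const q).mul (hum n))
      fun x => ?_
    refine .mul (.rpow (.lintegral (fun n => (hfm n).mul (hgm n)) fun y => ?_) hq)
      (increasesTo_truncate μ u x)
    exact (increasesTo_truncate μ f y).mul (increasesTo_truncate μ g y)
  refine hlim.limit_le fun n => ?_
  have hfin : IsFiniteMeasure (μ.withDensity (truncate μ u n)) := by
    refine isFiniteMeasure_withDensity ?_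
    simpa using lintegral_truncate_rpow_ne_top μ u n one_pos
  have hfg : ∫⁻ y, truncate μ f n y * truncate μ g n y ∂μ ≠ ∞ := by
    refine ne_top_of_le_ne_top ?_ (ENNReal.lintegral_mul_le_Lp_mul_Lq μ hp
      (hfm n).aemeasurable (hgm n).aemeasurable)
    exact ENNReal.mul_ne_top
      (ENNReal.rpow_ne_top_of_nonneg (by positivity) (lintegral_truncate_rpow_ne_top μ f n hp0))
      (ENNReal.rpow_ne_top_of_nonneg (by positivity) (lintegral_truncate_rpow_ne_top μ g n hp'0))
  have h := hardy_le_of_finite μ (μ.withDensity (truncate μ u n)) hp hq hr hpqr (hfm n) (hgm n) hfg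
  have hwd : ∀ s, MeasurableSet s → μ.withDensity (truncate μ u n) s =
      ∫⁻ x in s, truncate μ u n x ∂μ := fun s hs => withDensity_apply _ hs
  simp_rw [hwd _ measurableSet_Ioi] at h
  have hVW : Measurable fun t => (∫⁻ y in Iio t, truncate μ g n y ^ p' ∂μ) ^ (r / p') *
      (∫⁻ x in Ioi t, truncate μ u n x ∂μ) ^ (r / p) :=
    ((measurable_setLIntegral_Iio μ _).pow_const _).mul
      ((measurable_setLIntegral_Ioi μ _).pow_const _)
  rw [lintegral_withDensity_eq_lintegral_mul _ (hum n)
      ((measurable_setLIntegral_Iio μ _).pow_const q),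
    lintegral_withDensity_eq_lintegral_mul _ (hum n) hVW] at h
  simp only [Pi.mul_apply] at h
  calc _ = _ := lintegral_congr fun x => mul_comm _ _
    _ ≤ _ := h
    _ ≤ _ := by
      have hle : ∫⁻ t, truncate μ u n t * ((∫⁻ y in Iio t, truncate μ g n y ^ p' ∂μ) ^ (r / p') *
          (∫⁻ x in Ioi t, truncate μ u n x ∂μ) ^ (r / p)) ∂μ ≤ hardyConst μ p p' r g u := by
        refine lintegral_mono fun t => ?_
        rw [mul_comm]
        gcongr with y y
        · exact truncate_le μ g n y
        · exact truncate_le μ u n y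
        · exact truncate_le μ u n t
      gcongr with y
      exact truncate_le μ f n y

theorem hardyConst_lt_top_of_hardy (μ : Measure ℝ) [SigmaFinite μ] [NullSingletonClass μ]
    {p p' q r : ℝ} (hp : p.HolderConjugate p') (hq : 0 < q) (hr : 0 < r)
    (hpqr : r / p + 1 = r / q) {g u : ℝ → ℝ≥0∞} (hg : Measurable g) (hu : Measurable u)
    {K : ℝ≥0∞} (hKfin : K ≠ ∞)
    (hK : ∀ f : ℝ → ℝ≥0∞, Measurable f →
      ∫⁻ x, (∫⁻ y in Iio x, f y * g y ∂μ) ^ q * u x ∂μ ≤ K * (∫⁻ y, f y ^ p ∂μ) ^ (q / p)) :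
    hardyConst μ p p' r g u < ∞ := by
  have hp0 : 0 < p := hp.pos
  have hp'0 : 0 < p' := hp.symm.pos
  have hgm := measurable_truncate μ hg
  have hum := measurable_truncate μ hu
  have hlim : IncreasesTo (fun n => ∫⁻ t, (∫⁻ y in Iio t, truncate μ g n y ^ p' ∂μ) ^ (r / p')
      * (∫⁻ x in Ioi t, truncate μ u n x ∂μ) ^ (r / p) * truncate μ u n t ∂μ)
      (hardyConst μ p p' r g u) := by
    refine .lintegral (fun n => (((measurable_setLIntegral_Iio μ _).pow_const _).mul
        ((measurable_setLIntegral_Ioi μ _).pow_const _)).mul (hum n)) fun t => ?_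
    refine .mul (.mul (.rpow (.lintegral (fun n => (hgm n).pow_const _) fun y => ?_)
      (div_pos hr hp'0)) (.rpow (.lintegral hum fun y => ?_) (div_pos hr hp0)))
      (increasesTo_truncate μ u t)
    · exact (increasesTo_truncate μ g y).rpow hp'0
    · exact increasesTo_truncate μ u y
  have hconst : (ENNReal.ofReal (r / (p' * q)) ^ q *
      (K * (ENNReal.ofReal (r / q) / ENNReal.ofReal (r / p')) ^ (q / p))) ^ (r / q) < ∞ := by
    refine ENNReal.rpow_lt_top_of_nonneg (div_pos hr hq).le (ENNReal.mul_ne_top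
      (ENNReal.rpow_ne_top_of_nonneg hq.le ENNReal.ofReal_ne_top) (ENNReal.mul_ne_top hKfin
      (ENNReal.rpow_ne_top_of_nonneg (div_pos hq hp0).le
        (ENNReal.div_ne_top ENNReal.ofReal_ne_top ?_))))
    simpa using div_pos hr hp'0
  refine lt_of_le_of_lt (hlim.limit_le fun n => ?_) hconst
  have hfin : IsFiniteMeasure (μ.withDensity (truncate μ u n)) := by
    refine isFiniteMeasure_withDensity ?_
    simpa using lintegral_truncate_rpow_ne_top μ u n one_pos
  have hwd : ∀ s, MeasurableSet s → μ.withDensity (truncate μ u n) s =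
      ∫⁻ x in s, truncate μ u n x ∂μ := fun s hs => withDensity_apply _ hs
  have h := lintegral_le_of_hardy_of_finite μ (μ.withDensity (truncate μ u n)) hp hq hr hpqr
    (hgm n) (lintegral_truncate_rpow_ne_top μ g n hp'0) (K := K) fun f hf => by
      rw [lintegral_withDensity_eq_lintegral_mul _ (hum n)
        ((measurable_setLIntegral_Iio μ _).pow_const q)]
      refine le_trans (lintegral_mono fun x => ?_) (hK f hf)
      rw [Pi.mul_apply, mul_comm]
      gcongr with y
      · exact truncate_le μ g n y
      · exact truncate_le μ u n x
  simp_rw [hwd _ measurableSet_Ioi] at h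
  have hVW : Measurable fun t => (∫⁻ y in Iio t, truncate μ g n y ^ p' ∂μ) ^ (r / p') *
      (∫⁻ x in Ioi t, truncate μ u n x ∂μ) ^ (r / p) :=
    ((measurable_setLIntegral_Iio μ _).pow_const _).mul
      ((measurable_setLIntegral_Ioi μ _).pow_const _)
  rw [lintegral_withDensity_eq_lintegral_mul _ (hum n) hVW] at h
  exact le_trans (lintegral_congr fun x => mul_comm _ _).le h

section reflection

variable (μ : Measure ℝ)

lemma lintegral_map_neg (h : ℝ → ℝ≥0∞) : ∫⁻ x, h x ∂(μ.map Neg.neg) = ∫⁻ x, h (-x) ∂μ :=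
  measurableEmbedding_neg.lintegral_map _

lemma setLIntegral_Iio_map_neg (h : ℝ → ℝ≥0∞) (t : ℝ) :
    ∫⁻ x in Iio (-t), h x ∂(μ.map Neg.neg) = ∫⁻ x in Ioi t, h (-x) ∂μ := by
  rw [measurableEmbedding_neg.restrict_map, measurableEmbedding_neg.lintegral_map]
  congr 2
  ext x
  simp

lemma setLIntegral_Ioi_map_neg (h : ℝ → ℝ≥0∞) (t : ℝ) :
    ∫⁻ x in Ioi (-t), h x ∂(μ.map Neg.neg) = ∫⁻ x in Iio t, h (-x) ∂μ := by
  rw [measurableEmbedding_neg.restrict_map, measurableEmbedding_neg.lintegral_map]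
  congr 2
  ext x
  simp

instance [NullSingletonClass μ] : NullSingletonClass (μ.map (Neg.neg : ℝ → ℝ)) := ⟨fun x => by
  rw [Measure.map_apply measurable_neg (measurableSet_singleton x)]
  have : (Neg.neg ⁻¹' {x} : Set ℝ) = {-x} := by
    ext y
    simp
  rw [this, measure_singleton]⟩

instance [SigmaFinite μ] : SigmaFinite (μ.map (Neg.neg : ℝ → ℝ)) :=
  (MeasurableEquiv.neg ℝ).sigmaFinite_map

/-- The `r`-th power of the constant in the weighted inequality for the adjoint Hardy operator,
`q < p`. -/
def adjHardyConst (p p' r : ℝ) (g u : ℝ → ℝ≥0∞) : ℝ≥0∞ :=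
  ∫⁻ t, (∫⁻ y in Ioi t, g y ^ p' ∂μ) ^ (r / p') * (∫⁻ x in Iio t, u x ∂μ) ^ (r / p) * u t ∂μ

lemma hardyConst_map_neg (p p' r : ℝ) (g u : ℝ → ℝ≥0∞) :
    hardyConst (μ.map Neg.neg) p p' r (fun x => g (-x)) (fun x => u (-x)) =
      adjHardyConst μ p p' r g u := by
  simp only [hardyConst, adjHardyConst, lintegral_map_neg, setLIntegral_Iio_map_neg,
    setLIntegral_Ioi_map_neg, neg_neg]

variable [SigmaFinite μ] [NullSingletonClass μ] {p p' q r : ℝ}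

theorem adjHardy_le (hp : p.HolderConjugate p') (hq : 0 < q) (hr : 0 < r)
    (hpqr : r / p + 1 = r / q)
    {f g u : ℝ → ℝ≥0∞} (hf : Measurable f) (hg : Measurable g) (hu : Measurable u) :
    ∫⁻ x, (∫⁻ y in Ioi x, f y * g y ∂μ) ^ q * u x ∂μ ≤
      4 ^ q * ENNReal.ofReal (r / q) ^ (q / r) *
        (adjHardyConst μ p p' r g u ^ (q / r) * (∫⁻ y, f y ^ p ∂μ) ^ (q / p)) := by
  have h := hardy_le (μ.map Neg.neg) hp hq hr hpqr (hf.comp measurable_neg)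
    (hg.comp measurable_neg) (hu.comp measurable_neg)
  simpa only [Function.comp_def, hardyConst_map_neg, lintegral_map_neg, setLIntegral_Iio_map_neg,
    neg_neg] using h

theorem adjHardyConst_lt_top_of_adjHardy (hp : p.HolderConjugate p') (hq : 0 < q) (hr : 0 < r)
    (hpqr : r / p + 1 = r / q) {g u : ℝ → ℝ≥0∞} (hg : Measurable g) (hu : Measurable u)
    {K : ℝ≥0∞} (hKfin : K ≠ ∞)
    (hK : ∀ f : ℝ → ℝ≥0∞, Measurable f →
      ∫⁻ x, (∫⁻ y in Ioi x, f y * g y ∂μ) ^ q * u x ∂μ ≤ K * (∫⁻ y, f y ^ p ∂μ) ^ (q / p)) :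
    adjHardyConst μ p p' r g u < ∞ := by
  rw [← hardyConst_map_neg]
  refine hardyConst_lt_top_of_hardy (μ.map Neg.neg) hp hq hr hpqr (hg.comp measurable_neg)
    (hu.comp measurable_neg) hKfin fun f hf => ?_
  simpa only [Function.comp_def, lintegral_map_neg, setLIntegral_Iio_map_neg,
    neg_neg] using hK _ (hf.comp measurable_neg)

end reflection

/-- Lebesgue measure on the half-line. -/
def halfLine : Measure ℝ := volume.restrict (Ioi 0)

instance : SigmaFinite halfLine := inferInstanceAs (SigmaFinite (volume.restrict (Ioi (0 : ℝ))))

instance : NullSingletonClass halfLine :=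
  inferInstanceAs (NullSingletonClass (volume.restrict (Ioi (0 : ℝ))))

lemma setLIntegral_Iio_halfLine (h : ℝ → ℝ≥0∞) (t : ℝ) :
    ∫⁻ y in Iio t, h y ∂halfLine = ∫⁻ y in Ioo 0 t, h y := by
  rw [halfLine, Measure.restrict_restrict measurableSet_Iio, inter_comm, Ioi_inter_Iio]

lemma setLIntegral_Ioi_halfLine (h : ℝ → ℝ≥0∞) {t : ℝ} (ht : 0 < t) :
    ∫⁻ y in Ioi t, h y ∂halfLine = ∫⁻ y in Ioi t, h y := by
  rw [halfLine, Measure.restrict_restrict measurableSet_Ioi,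
    inter_eq_left.2 (Ioi_subset_Ioi ht.le)]

lemma ae_halfLine_pos : ∀ᵐ x ∂halfLine, 0 < x := ae_restrict_mem measurableSet_Ioi

/-- The Stieltjes kernel `1 / (x^λ + y^λ)`. -/
def stieltjesKernel (lam x y : ℝ) : ℝ≥0∞ :=
  (ENNReal.ofReal (x ^ lam) + ENNReal.ofReal (y ^ lam))⁻¹

/-- The Stieltjes-type operator on non-negative functions, without the outer weight. -/
def stieltjes (lam : ℝ) (v : ℝ → ℝ) (f : ℝ → ℝ≥0∞) (x : ℝ) : ℝ≥0∞ :=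
  ∫⁻ y, f y * (ENNReal.ofReal (v y) * stieltjesKernel lam x y) ∂halfLine

lemma measurable_uncurry_stieltjesKernel (lam : ℝ) :
    Measurable (Function.uncurry (stieltjesKernel lam)) := by
  unfold stieltjesKernel
  fun_prop

lemma measurable_stieltjesKernel (lam x : ℝ) : Measurable (stieltjesKernel lam x) := by
  unfold stieltjesKernel
  fun_prop

lemma stieltjesKernel_comm (lam x y : ℝ) : stieltjesKernel lam x y = stieltjesKernel lam y x := by
  rw [stieltjesKernel, add_comm, stieltjesKernel]

lemma stieltjesKernel_le {lam x : ℝ} (hx : 0 < x) (y : ℝ) :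
    stieltjesKernel lam x y ≤ ENNReal.ofReal x ^ (-lam) := by
  rw [ENNReal.rpow_neg, ENNReal.ofReal_rpow_of_pos hx]
  exact ENNReal.inv_le_inv.2 le_self_add

lemma rpow_neg_le_stieltjesKernel {lam x y : ℝ} (hlam : 0 < lam) (hy : 0 < y) (hxy : y ≤ x) :
    ENNReal.ofReal x ^ (-lam) ≤ 2 * stieltjesKernel lam x y := by
  have hx : 0 < x := hy.trans_le hxy
  have h2 : ENNReal.ofReal x ^ (-lam) =
      2 * (ENNReal.ofReal (x ^ lam) + ENNReal.ofReal (x ^ lam))⁻¹ := by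
    rw [ENNReal.rpow_neg, ENNReal.ofReal_rpow_of_pos hx, ← two_mul,
      ENNReal.mul_inv (by simp) (by simp), ← mul_assoc, ENNReal.mul_inv_cancel (by simp) (by simp),
      one_mul]
  rw [h2, stieltjesKernel]
  gcongr

lemma measurable_stieltjes (lam : ℝ) {v : ℝ → ℝ} (hv : Measurable v) {f : ℝ → ℝ≥0∞}
    (hf : Measurable f) : Measurable (stieltjes lam v f) := by
  refine Measurable.lintegral_prod_right' (f := fun z : ℝ × ℝ =>
    f z.2 * (ENNReal.ofReal (v z.2) * stieltjesKernel lam z.1 z.2)) ?_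
  have := measurable_uncurry_stieltjesKernel lam
  fun_prop

section comparison

variable {lam : ℝ} {v : ℝ → ℝ} (hv : Measurable v) {f : ℝ → ℝ≥0∞} (hf : Measurable f) {x : ℝ}
include hv hf

lemma stieltjes_le (hx : 0 < x) :
    stieltjes lam v f x ≤
      ENNReal.ofReal x ^ (-lam) * ∫⁻ y in Iio x, f y * ENNReal.ofReal (v y) ∂halfLine +
      ∫⁻ y in Ioi x, f y * (ENNReal.ofReal y ^ (-lam) * ENNReal.ofReal (v y)) ∂halfLine := by
  have hm := measurable_stieltjesKernel lam x
  rw [stieltjes, ← lintegral_add_compl _ (measurableSet_Iio (a := x)), compl_Iio,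
    ← setLIntegral_congr (Ioi_ae_eq_Ici (μ := halfLine)),
    ← lintegral_const_mul _ (by fun_prop)]
  gcongr ?_ + ?_
  · refine lintegral_mono fun y => ?_
    calc _ = stieltjesKernel lam x y * (f y * ENNReal.ofReal (v y)) := by ring
      _ ≤ _ := by gcongr; exact stieltjesKernel_le hx y
  · refine setLIntegral_mono' measurableSet_Ioi fun y hy => ?_
    rw [mul_comm (ENNReal.ofReal y ^ (-lam)), stieltjesKernel_comm]
    gcongr
    exact stieltjesKernel_le (hx.trans hy) x

lemma setLIntegral_Iio_le_stieltjes (hlam : 0 < lam) :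
    ENNReal.ofReal x ^ (-lam) * ∫⁻ y in Iio x, f y * ENNReal.ofReal (v y) ∂halfLine ≤
      2 * stieltjes lam v f x := by
  have hm := measurable_stieltjesKernel lam x
  rw [stieltjes, ← lintegral_const_mul _ (by fun_prop), ← lintegral_const_mul _ (by fun_prop)]
  refine (lintegral_mono_ae ?_).trans (setLIntegral_le_lintegral (Iio x) _)
  filter_upwards [ae_restrict_of_ae ae_halfLine_pos, ae_restrict_mem measurableSet_Iio] with y h0 hy
  calc _ ≤ 2 * stieltjesKernel lam x y * (f y * ENNReal.ofReal (v y)) := by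
        gcongr; exact rpow_neg_le_stieltjesKernel hlam h0 (le_of_lt hy)
    _ = _ := by ring

lemma setLIntegral_Ioi_le_stieltjes (hlam : 0 < lam) (hx : 0 < x) :
    ∫⁻ y in Ioi x, f y * (ENNReal.ofReal y ^ (-lam) * ENNReal.ofReal (v y)) ∂halfLine ≤
      2 * stieltjes lam v f x := by
  have hm := measurable_stieltjesKernel lam x
  rw [stieltjes, ← lintegral_const_mul _ (by fun_prop)]
  refine (lintegral_mono_ae ?_).trans (setLIntegral_le_lintegral (Ioi x) _)
  filter_upwards [ae_restrict_mem measurableSet_Ioi] with y hy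
  calc _ ≤ f y * (2 * stieltjesKernel lam y x * ENNReal.ofReal (v y)) := by
        gcongr; exact rpow_neg_le_stieltjesKernel hlam hx (le_of_lt hy)
    _ = _ := by rw [stieltjesKernel_comm]; ring

end comparison

lemma ENNReal.add_rpow_le {q : ℝ} (hq : 0 < q) (a b : ℝ≥0∞) :
    (a + b) ^ q ≤ 2 ^ q * (a ^ q + b ^ q) := by
  calc (a + b) ^ q ≤ (2 * max a b) ^ q := by
        gcongr
        rw [two_mul]
        exact add_le_add (le_max_left _ _) (le_max_right _ _)
    _ = 2 ^ q * max a b ^ q := ENNReal.mul_rpow_of_nonneg _ _ hq.le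
    _ ≤ _ := by
        gcongr
        rcases le_total a b with h | h
        · rw [max_eq_right h]; exact le_add_self
        · rw [max_eq_left h]; exact le_self_add

/-- The `r`-th power of `B_H`, with `w^q` replaced by a general weight `u`. -/
def stieltjesBH (lam p p' q r : ℝ) (v : ℝ → ℝ) (u : ℝ → ℝ≥0∞) : ℝ≥0∞ :=
  hardyConst halfLine p p' r (fun y => ENNReal.ofReal (v y))
    fun x => ENNReal.ofReal x ^ (-(lam * q)) * u x

/-- The `r`-th power of `B_{H*}`, with `w^q` replaced by a general weight `u`. -/
def stieltjesBHadj (lam p p' r : ℝ) (v : ℝ → ℝ) (u : ℝ → ℝ≥0∞) : ℝ≥0∞ :=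
  adjHardyConst halfLine p p' r (fun y => ENNReal.ofReal y ^ (-lam) * ENNReal.ofReal (v y)) u

lemma rpow_neg_mul (a : ℝ≥0∞) (b c : ℝ) : a ^ (-(b * c)) = (a ^ (-b)) ^ c := by
  rw [← ENNReal.rpow_mul, neg_mul]

section boundedness

variable {lam p p' q r : ℝ} (hp : p.HolderConjugate p') (hq : 0 < q) (hr : 0 < r)
  (hpqr : r / p + 1 = r / q) {v : ℝ → ℝ} (hv : Measurable v) {u : ℝ → ℝ≥0∞} (hu : Measurable u)
include hp hq hr hpqr hv hu

theorem lintegral_stieltjes_rpow_le {f : ℝ → ℝ≥0∞} (hf : Measurable f) :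
    ∫⁻ x, stieltjes lam v f x ^ q * u x ∂halfLine ≤
      2 ^ q * (4 ^ q * ENNReal.ofReal (r / q) ^ (q / r)) *
        (stieltjesBH lam p p' q r v u ^ (q / r) + stieltjesBHadj lam p p' r v u ^ (q / r)) *
        (∫⁻ y, f y ^ p ∂halfLine) ^ (q / p) := by
  have hg₁ : Measurable fun y => ENNReal.ofReal (v y) := by fun_prop
  have hu₁ : Measurable fun x => ENNReal.ofReal x ^ (-(lam * q)) * u x := by fun_prop
  have hg₂ : Measurable fun y => ENNReal.ofReal y ^ (-lam) * ENNReal.ofReal (v y) := by fun_prop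
  have h₁ := hardy_le halfLine hp hq hr hpqr hf hg₁ hu₁
  have h₂ := adjHardy_le halfLine hp hq hr hpqr hf hg₂ hu
  calc _ ≤ ∫⁻ x, 2 ^ q * ((∫⁻ y in Iio x, f y * ENNReal.ofReal (v y) ∂halfLine) ^ q *
          (ENNReal.ofReal x ^ (-(lam * q)) * u x) +
          (∫⁻ y in Ioi x, f y * (ENNReal.ofReal y ^ (-lam) * ENNReal.ofReal (v y)) ∂halfLine) ^ q
            * u x) ∂halfLine := by
        refine lintegral_mono_ae ?_
        filter_upwards [ae_halfLine_pos] with x hx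
        calc _ ≤ _ := mul_le_mul_left (ENNReal.rpow_le_rpow (stieltjes_le hv hf hx) hq.le) _
          _ ≤ _ := mul_le_mul_left (ENNReal.add_rpow_le hq _ _) _
          _ = _ := by
            rw [ENNReal.mul_rpow_of_nonneg _ _ hq.le, rpow_neg_mul]
            ring
    _ = 2 ^ q * (_ + _) := by
        rw [lintegral_const_mul' _ _ (by simp), lintegral_add_left]
        exact ((measurable_setLIntegral_Iio _ _).pow_const _).mul hu₁
    _ ≤ _ := mul_le_mul_right (add_le_add h₁ h₂) _
    _ = _ := by
      simp only [stieltjesBH, stieltjesBHadj]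
      ring

variable (hlam : 0 < lam) {K : ℝ≥0∞} (hKfin : K ≠ ∞) (hK : ∀ f : ℝ → ℝ≥0∞, Measurable f →
  ∫⁻ x, stieltjes lam v f x ^ q * u x ∂halfLine ≤ K * (∫⁻ y, f y ^ p ∂halfLine) ^ (q / p))
include hlam hKfin hK

theorem stieltjesBH_lt_top : stieltjesBH lam p p' q r v u < ∞ := by
  refine hardyConst_lt_top_of_hardy halfLine hp hq hr hpqr (by fun_prop) (by fun_prop)
    (K := 2 ^ q * K) (ENNReal.mul_ne_top (by simp) hKfin) fun f hf => ?_
  calc _ ≤ ∫⁻ x, 2 ^ q * (stieltjes lam v f x ^ q * u x) ∂halfLine := by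
        refine lintegral_mono_ae ?_
        filter_upwards [ae_halfLine_pos] with x hx
        rw [← mul_assoc, ← mul_assoc, ← ENNReal.mul_rpow_of_nonneg _ _ hq.le, rpow_neg_mul,
          ← ENNReal.mul_rpow_of_nonneg _ _ hq.le]
        gcongr ?_ ^ q * u x
        rw [mul_comm]
        exact setLIntegral_Iio_le_stieltjes hv hf hlam
    _ = 2 ^ q * _ := lintegral_const_mul' _ _ (by simp)
    _ ≤ _ := by
        rw [mul_assoc]
        gcongr
        exact hK f hf

theorem stieltjesBHadj_lt_top : stieltjesBHadj lam p p' r v u < ∞ := by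
  refine adjHardyConst_lt_top_of_adjHardy halfLine hp hq hr hpqr (by fun_prop) (by fun_prop)
    (K := 2 ^ q * K) (ENNReal.mul_ne_top (by simp) hKfin) fun f hf => ?_
  calc _ ≤ ∫⁻ x, 2 ^ q * (stieltjes lam v f x ^ q * u x) ∂halfLine := by
        refine lintegral_mono_ae ?_
        filter_upwards [ae_halfLine_pos] with x hx
        rw [← mul_assoc, ← ENNReal.mul_rpow_of_nonneg _ _ hq.le]
        gcongr
        exact setLIntegral_Ioi_le_stieltjes hv hf hlam hx
    _ = 2 ^ q * _ := lintegral_const_mul' _ _ (by simp)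
    _ ≤ _ := by
        rw [mul_assoc]
        gcongr
        exact hK f hf

end boundedness

lemma stieltjesBH_eq (lam p p' q r : ℝ) (v w : ℝ → ℝ) :
    stieltjesBH lam p p' q r v (fun x => ENNReal.ofReal (w x) ^ q) =
      ∫⁻ t in Ioi (0:ℝ), (V0 p' v t) ^ (r/p') * (Winf lam q w t) ^ (r/p)
        * (ENNReal.ofReal t) ^ (-(lam * q)) * ENNReal.ofReal (w t) ^ q := by
  refine setLIntegral_congr_fun measurableSet_Ioi fun t ht => ?_
  simp only [setLIntegral_Iio_halfLine, setLIntegral_Ioi_halfLine _ ht, V0, Winf, mul_assoc]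

lemma stieltjesBHadj_eq (lam p : ℝ) {p' : ℝ} (hp' : 0 < p') (q r : ℝ) (v w : ℝ → ℝ) :
    stieltjesBHadj lam p p' r v (fun x => ENNReal.ofReal (w x) ^ q) =
      ∫⁻ t in Ioi (0:ℝ), (Vinf lam p' v t) ^ (r/p') * (W0 q w t) ^ (r/p)
        * ENNReal.ofReal (w t) ^ q := by
  refine setLIntegral_congr_fun measurableSet_Ioi fun t ht => ?_
  simp only [setLIntegral_Iio_halfLine, setLIntegral_Ioi_halfLine _ ht, Vinf, W0,
    ENNReal.mul_rpow_of_nonneg _ _ hp'.le, rpow_neg_mul]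

/-- A converse of Hölder's inequality. -/
lemma lintegral_rpow_lt_top_of_forall_lintegral_mul_le (μ : Measure ℝ) [SigmaFinite μ]
    {p p' : ℝ} (hp : p.HolderConjugate p') {h : ℝ → ℝ≥0∞} (hh : Measurable h) {K : ℝ≥0∞}
    (hKfin : K ≠ ∞)
    (hK : ∀ f : ℝ → ℝ≥0∞, Measurable f → ∫⁻ x, f x * h x ∂μ ≤ K * (∫⁻ x, f x ^ p ∂μ) ^ (1 / p)) :
    ∫⁻ x, h x ^ p' ∂μ < ∞ := by
  have hp'0 : 0 < p' := hp.symm.pos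
  have hp'1 : 0 < p' - 1 := sub_pos.2 hp.symm.lt
  have hmul : (p' - 1) * p = p' := hp.symm.sub_one_mul_conj
  have hadd : 1 / p + 1 / p' = 1 := by simpa using hp.inv_add_inv_eq_one
  have hlim : IncreasesTo (fun n => ∫⁻ x, truncate μ h n x ^ p' ∂μ) (∫⁻ x, h x ^ p' ∂μ) :=
    .lintegral (fun n => (measurable_truncate μ hh n).pow_const _)
      fun x => (increasesTo_truncate μ h x).rpow hp'0
  refine lt_of_le_of_lt (hlim.limit_le fun n => ?_)
    (ENNReal.rpow_lt_top_of_nonneg hp'0.le hKfin)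
  have hA := lintegral_truncate_rpow_ne_top μ h n hp'0
  have hle : ∫⁻ x, truncate μ h n x ^ p' ∂μ ≤
      K * (∫⁻ x, truncate μ h n x ^ p' ∂μ) ^ (1 / p) := by
    have h1 := hK (fun x => truncate μ h n x ^ (p' - 1))
      ((measurable_truncate μ hh n).pow_const _)
    simp only [← ENNReal.rpow_mul, hmul] at h1
    refine (lintegral_mono fun x => ?_).trans h1
    calc truncate μ h n x ^ p' = truncate μ h n x ^ (p' - 1) * truncate μ h n x := by
          conv_rhs => rw [← ENNReal.rpow_one (truncate μ h n x), ← ENNReal.rpow_mul, one_mul]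
          rw [← ENNReal.rpow_add_of_nonneg _ _ hp'1.le zero_le_one, sub_add_cancel]
      _ ≤ _ := by
          gcongr
          exact truncate_le μ h n x
  set A := ∫⁻ x, truncate μ h n x ^ p' ∂μ
  rcases eq_or_ne A 0 with h0 | h0
  · rw [h0]; exact bot_le
  · have hA0 : A ^ (1 / p) ≠ 0 := by
      simp [ENNReal.rpow_eq_zero_iff, h0, hA]
    have hAt : A ^ (1 / p) ≠ ∞ :=
      ENNReal.rpow_ne_top_of_nonneg (one_div_pos.2 hp.pos).le hA
    have hle' : A ^ (1 / p') ≤ K := by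
      refine (ENNReal.mul_le_mul_iff_left hA0 hAt).1 ?_
      rwa [← ENNReal.rpow_add _ _ h0 hA, add_comm, hadd, ENNReal.rpow_one]
    calc A = (A ^ (1 / p')) ^ p' := by
          rw [← ENNReal.rpow_mul, one_div_mul_cancel hp'0.ne', ENNReal.rpow_one]
      _ ≤ _ := ENNReal.rpow_le_rpow hle' hp'0.le

/-- The `q`-th power of the `L^q(0,∞)` quasi-norm. -/
def lqPow (q : ℝ) (g : ℝ → ℝ) : ℝ≥0∞ := ∫⁻ x, ENNReal.ofReal |g x| ^ q ∂halfLine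

lemma lqPow_lt_one_of_dS {q : ℝ} (hq : 0 < q) {g : ℝ → ℝ} (h : dS q g < ENNReal.ofReal 1) :
    lqPow q g < 1 := by
  rw [ENNReal.ofReal_one, dS] at h
  split_ifs at h with h1
  · by_contra! h2
    exact absurd (ENNReal.one_le_rpow h2 (one_div_pos.2 hq)) (not_le.2 h)
  · exact h

lemma exists_forall_lqPow_lt_dS_lt {q : ℝ} (hq : 0 < q) {ε : ℝ} (hε : 0 < ε) :
    ∃ δ : ℝ≥0∞, 0 < δ ∧ ∀ g, lqPow q g < δ → dS q g < ENNReal.ofReal ε := by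
  have hε' : 0 < ENNReal.ofReal ε := ENNReal.ofReal_pos.2 hε
  by_cases h1 : 1 ≤ q
  · refine ⟨ENNReal.ofReal ε ^ q, ENNReal.rpow_pos hε' ENNReal.ofReal_ne_top, fun g hg => ?_⟩
    rw [dS, if_pos h1]
    refine (ENNReal.rpow_lt_rpow hg (one_div_pos.2 hq)).trans_le ?_
    rw [← ENNReal.rpow_mul, mul_one_div_cancel hq.ne', ENNReal.rpow_one]
  · exact ⟨_, hε', fun g hg => by rwa [dS, if_neg h1]⟩

lemma eN_le_one_iff {p : ℝ} (hp : 0 < p) {f : ℝ → ℝ} :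
    eN p f ≤ 1 ↔ ∫⁻ x, ENNReal.ofReal |f x| ^ p ∂halfLine ≤ 1 := by
  rw [eN, ← halfLine]
  constructor
  · intro h
    have := ENNReal.rpow_le_rpow h hp.le
    rwa [← ENNReal.rpow_mul, one_div_mul_cancel hp.ne', ENNReal.rpow_one, ENNReal.one_rpow] at this
  · intro h
    have := ENNReal.rpow_le_rpow h (one_div_pos.2 hp).le
    rwa [ENNReal.one_rpow] at this

section operator

variable {lam : ℝ} {v w : ℝ → ℝ}

lemma SOp_const_mul (c : ℝ) (f : ℝ → ℝ) (x : ℝ) :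
    SOp lam v w (fun y => c * f y) x = c * SOp lam v w f x := by
  simp only [SOp, mul_assoc, mul_div_assoc, integral_const_mul]
  ring

lemma measurable_SOp (hv : Measurable v) (hw : Measurable w) {f : ℝ → ℝ} (hf : Measurable f) :
    Measurable (SOp lam v w f) := by
  refine hw.mul (StronglyMeasurable.integral_prod_right
    (f := fun x y : ℝ => f y * v y / (x ^ lam + y ^ lam)) ?_).measurable
  exact Measurable.stronglyMeasurable (by unfold Function.uncurry; fun_prop)

lemma ofReal_mul_div_eq {x y a b : ℝ} (hx : 0 < x) (hy : 0 < y) (ha : 0 ≤ a) :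
    ENNReal.ofReal (a * b / (x ^ lam + y ^ lam)) =
      ENNReal.ofReal a * (ENNReal.ofReal b * stieltjesKernel lam x y) := by
  have hx' : 0 < x ^ lam := Real.rpow_pos_of_pos hx _
  have hy' : 0 < y ^ lam := Real.rpow_pos_of_pos hy _
  rw [ENNReal.ofReal_div_of_pos (by positivity), ENNReal.ofReal_mul ha,
    ENNReal.ofReal_add hx'.le hy'.le, div_eq_mul_inv, mul_assoc, stieltjesKernel]

lemma ofReal_abs_SOp (hv : Measurable v) (hvpos : ∀ y, 0 ≤ v y) (hwpos : ∀ x, 0 ≤ w x)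
    {h : ℝ → ℝ≥0∞} (hh : Measurable h) (hfin : ∀ y, h y ≠ ∞) {x : ℝ} (hx : 0 < x)
    (hTfin : stieltjes lam v h x ≠ ∞) :
    ENNReal.ofReal |SOp lam v w (fun y => (h y).toReal) x| =
      ENNReal.ofReal (w x) * stieltjes lam v h x := by
  have hnn : ∀ᵐ y ∂halfLine, 0 ≤ (h y).toReal * v y / (x ^ lam + y ^ lam) := by
    filter_upwards [ae_halfLine_pos] with y hy
    have := hvpos y
    positivity
  have hint : ∫ y, (h y).toReal * v y / (x ^ lam + y ^ lam) ∂halfLine =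
      (stieltjes lam v h x).toReal := by
    rw [integral_eq_lintegral_of_nonneg_ae hnn
      (Measurable.aestronglyMeasurable (by fun_prop)), stieltjes]
    congr 1
    refine lintegral_congr_ae ?_
    filter_upwards [ae_halfLine_pos] with y hy
    rw [ofReal_mul_div_eq hx hy ENNReal.toReal_nonneg, ENNReal.ofReal_toReal (hfin y)]
  rw [SOp, ← halfLine, hint, abs_of_nonneg (mul_nonneg (hwpos x) ENNReal.toReal_nonneg),
    ENNReal.ofReal_mul (hwpos x), ENNReal.ofReal_toReal hTfin]

lemma stieltjes_const_mul (hv : Measurable v) {f : ℝ → ℝ≥0∞} (hf : Measurable f) (c : ℝ≥0∞)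
    (x : ℝ) : stieltjes lam v (fun y => c * f y) x = c * stieltjes lam v f x := by
  have := measurable_stieltjesKernel lam x
  simp only [stieltjes, mul_assoc]
  exact lintegral_const_mul _ (by fun_prop)

end operator

section necessity

variable {lam p q : ℝ} {v w : ℝ → ℝ}

lemma lqPow_const_mul {q : ℝ} (hq : 0 < q) (c : ℝ) (g : ℝ → ℝ) :
    lqPow q (fun x => c * g x) = ENNReal.ofReal |c| ^ q * lqPow q g := by
  simp only [lqPow, abs_mul, ENNReal.ofReal_mul (abs_nonneg _),
    ENNReal.mul_rpow_of_nonneg _ _ hq.le]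
  exact lintegral_const_mul' _ _ (ENNReal.rpow_ne_top_of_nonneg hq.le ENNReal.ofReal_ne_top)

lemma lqPow_le_of_sub {q : ℝ} (hq : 0 < q) {g h : ℝ → ℝ} (hg : Measurable g) (hh : Measurable h) :
    lqPow q g ≤ 2 ^ q * (lqPow q (fun x => g x - h x) + lqPow q h) := by
  simp only [lqPow]
  rw [← lintegral_add_left (by fun_prop), ← lintegral_const_mul' _ _ (by simp)]
  refine lintegral_mono fun x => le_trans (ENNReal.rpow_le_rpow ?_ hq.le)
    (ENNReal.add_rpow_le hq _ _)
  rw [← ENNReal.ofReal_add (abs_nonneg _) (abs_nonneg _)]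
  exact ENNReal.ofReal_le_ofReal (by simpa using abs_add_le (g x - h x) (h x))

lemma SCompact.lqPow_lt_top (hS : SCompact lam p q v w) (hp : 0 < p) (hq : 0 < q) {f : ℝ → ℝ}
    (hf : Measurable f) (hf1 : eN p f ≤ 1) : lqPow q (SOp lam v w f) < ∞ := by
  obtain ⟨φ, hφ, hC⟩ := hS (fun n y => 1 / ((n : ℝ) + 1) * f y) (fun n => by fun_prop) fun n => by
    rw [eN_le_one_iff hp] at hf1 ⊢
    refine le_trans (lintegral_mono fun y => ?_) hf1
    refine ENNReal.rpow_le_rpow (ENNReal.ofReal_le_ofReal ?_) hp.le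
    rw [abs_mul, abs_of_pos Nat.one_div_pos_of_nat]
    refine mul_le_of_le_one_left (abs_nonneg _) ?_
    rw [div_le_one (by positivity)]
    linarith [(Nat.cast_nonneg n : (0 : ℝ) ≤ n)]
  obtain ⟨N, hN⟩ := hC 1 one_pos
  have h1 := lqPow_lt_one_of_dS hq (hN N le_rfl (N + 1) N.le_succ)
  simp only [SOp_const_mul, ← sub_mul] at h1
  rw [lqPow_const_mul hq] at h1
  have hc : (1 / ((φ N : ℝ) + 1) - 1 / ((φ (N + 1) : ℝ) + 1)) ≠ 0 :=
    (sub_pos.2 (Nat.one_div_lt_one_div (hφ N.lt_succ_self))).ne'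
  refine lt_top_iff_ne_top.2 fun htop => ?_
  rw [htop, ENNReal.mul_top] at h1
  · simp at h1
  · exact (ENNReal.rpow_pos (ENNReal.ofReal_pos.2 (abs_pos.2 hc)) ENNReal.ofReal_ne_top).ne'

lemma SCompact.exists_lqPow_le (hS : SCompact lam p q v w) (hp : 0 < p) (hq : 0 < q)
    (hv : Measurable v) (hw : Measurable w) :
    ∃ K : ℝ≥0∞, K ≠ ∞ ∧
      ∀ f : ℝ → ℝ, Measurable f → eN p f ≤ 1 → lqPow q (SOp lam v w f) ≤ K := by
  by_contra! hcon
  choose f hf hf1 hlt using fun n : ℕ => hcon n (by simp)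
  obtain ⟨φ, hφ, hC⟩ := hS f hf hf1
  obtain ⟨N, hN⟩ := hC 1 one_pos
  have hm : ∀ n, Measurable (SOp lam v w (f n)) := fun n => measurable_SOp hv hw (hf n)
  have hfin : 2 ^ q * (1 + lqPow q (SOp lam v w (f (φ N)))) ≠ ∞ :=
    ENNReal.mul_ne_top (by simp) (ENNReal.add_ne_top.2
      ⟨by simp, (hS.lqPow_lt_top hp hq (hf _) (hf1 _)).ne⟩)
  obtain ⟨n, hn⟩ := ENNReal.exists_nat_gt hfin
  have h1 := lqPow_lt_one_of_dS hq (hN (max n N) (le_max_right _ _) N le_rfl)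
  have h2 := lqPow_le_of_sub hq (hm (φ (max n N))) (hm (φ N))
  refine absurd (hlt (φ (max n N))) (not_lt.2 (h2.trans (le_trans ?_ (hn.le.trans ?_))))
  · gcongr
  · exact_mod_cast (le_max_left n N).trans (hφ.id_le _)

theorem SCompact.exists_lintegral_stieltjes_le (hS : SCompact lam p q v w) (hp : 0 < p)
    (hq : 0 < q) (hv : Measurable v) (hw : Measurable w) (hvpos : ∀ y, 0 ≤ v y)
    (hwpos : ∀ x, 0 ≤ w x) :
    ∃ K : ℝ≥0∞, K ≠ ∞ ∧ ∀ f : ℝ → ℝ≥0∞, Measurable f →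
      ∫⁻ x, stieltjes lam v f x ^ q * ENNReal.ofReal (w x) ^ q ∂halfLine ≤
        K * (∫⁻ y, f y ^ p ∂halfLine) ^ (q / p) := by
  obtain ⟨K, hKfin, hK⟩ := hS.exists_lqPow_le hp hq hv hw
  refine ⟨K + 1, by simp [hKfin], fun f hf => ?_⟩
  rcases eq_or_ne (∫⁻ y, f y ^ p ∂halfLine) ∞ with htop | htop
  · rw [htop, ENNReal.top_rpow_of_pos (div_pos hq hp), ENNReal.mul_top (by simp)]
    exact le_top
  rcases eq_or_ne (∫⁻ y, f y ^ p ∂halfLine) 0 with h0 | h0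
  · have hf0 : ∀ᵐ y ∂halfLine, f y = 0 := by
      filter_upwards [(lintegral_eq_zero_iff (by fun_prop)).1 h0] with y hy
      simpa [hp, hp.not_gt] using hy
    have hT : ∀ x, stieltjes lam v f x = 0 := fun x => by
      rw [stieltjes, ← lintegral_zero]
      refine lintegral_congr_ae ?_
      filter_upwards [hf0] with y hy
      rw [hy, zero_mul]
    simp [hT, hq]
  set A := ∫⁻ y, f y ^ p ∂halfLine with hA
  let ν := halfLine + halfLine.withDensity fun y => ENNReal.ofReal (v y)
  have : SigmaFinite (halfLine.withDensity fun y => ENNReal.ofReal (v y)) :=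
    SigmaFinite.withDensity_ofReal _
  have hνfin : ∀ n, ∫⁻ y, truncate ν f n y * ENNReal.ofReal (v y) ∂halfLine ≠ ∞ := fun n => by
    have h := lintegral_truncate_rpow_ne_top ν f n one_pos
    simp only [ENNReal.rpow_one] at h
    rw [lintegral_add_measure, ENNReal.add_ne_top,
      lintegral_withDensity_eq_lintegral_mul _ (by fun_prop) (measurable_truncate ν hf n)] at h
    simpa only [Pi.mul_apply, mul_comm] using h.2
  have htm := measurable_truncate ν hf
  have hlim : IncreasesTo
      (fun n => ∫⁻ x, stieltjes lam v (truncate ν f n) x ^ q * ENNReal.ofReal (w x) ^ q ∂halfLine)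
      (∫⁻ x, stieltjes lam v f x ^ q * ENNReal.ofReal (w x) ^ q ∂halfLine) := by
    refine .lintegral (fun n => ((measurable_stieltjes lam hv (htm n)).pow_const q).mul
      (by fun_prop)) fun x => ?_
    refine .mul (.rpow (.lintegral (fun n => ?_) fun y => ?_) hq) (.const _)
    · have := measurable_stieltjesKernel lam x
      have := htm n
      fun_prop
    · exact (increasesTo_truncate ν f y).mul (.const _)
  refine hlim.limit_le fun n => ?_
  set c := A ^ (-(1 / p)) with hc
  have hc0 : c ≠ 0 := by simp [hc, ENNReal.rpow_eq_zero_iff, h0, htop]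
  have hct : c ≠ ∞ := by simp [hc, ENNReal.rpow_eq_top_iff, h0, htop]
  have hcp : c ^ p = A⁻¹ := by
    rw [hc, ← ENNReal.rpow_mul, neg_mul, one_div_mul_cancel hp.ne', ENNReal.rpow_neg_one]
  have hcq : (c ^ q)⁻¹ = A ^ (q / p) := by
    rw [hc, ← ENNReal.rpow_mul, ← ENNReal.rpow_neg]
    congr 1
    ring
  have hhm : Measurable fun y => c * truncate ν f n y := (htm n).const_mul c
  have hhfin : ∀ y, c * truncate ν f n y ≠ ∞ := fun y => by
    refine ENNReal.mul_ne_top hct (ne_top_of_le_ne_top (ENNReal.natCast_ne_top n) ?_)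
    simp only [truncate, indicator]
    split_ifs
    · exact min_le_right _ _
    · exact bot_le
  have hunit : eN p (fun y => (c * truncate ν f n y).toReal) ≤ 1 := by
    rw [eN_le_one_iff hp]
    calc _ = ∫⁻ y, c ^ p * truncate ν f n y ^ p ∂halfLine := by
          refine lintegral_congr fun y => ?_
          rw [abs_of_nonneg ENNReal.toReal_nonneg, ENNReal.ofReal_toReal (hhfin y),
            ENNReal.mul_rpow_of_nonneg _ _ hp.le]
      _ = c ^ p * ∫⁻ y, truncate ν f n y ^ p ∂halfLine :=
          lintegral_const_mul _ ((htm n).pow_const _)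
      _ ≤ A⁻¹ * A := by
          rw [hcp, hA]
          gcongr with y
          exact truncate_le ν f n y
      _ = 1 := ENNReal.inv_mul_cancel h0 htop
  have hb := hK _ hhm.ennreal_toReal hunit
  have heq : lqPow q (SOp lam v w fun y => (c * truncate ν f n y).toReal) = c ^ q *
      ∫⁻ x, stieltjes lam v (truncate ν f n) x ^ q * ENNReal.ofReal (w x) ^ q ∂halfLine := by
    rw [lqPow, ← lintegral_const_mul' _ _ (ENNReal.rpow_ne_top_of_nonneg hq.le hct)]
    refine lintegral_congr_ae ?_
    filter_upwards [ae_halfLine_pos] with x hx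
    have hTfin : stieltjes lam v (truncate ν f n) x ≠ ∞ := by
      refine ne_top_of_le_ne_top (ENNReal.mul_ne_top (hνfin n)
        (b := ENNReal.ofReal x ^ (-lam)) (by simp [ENNReal.rpow_eq_top_iff, hx])) ?_
      rw [stieltjes, ← lintegral_mul_const _ (by have := htm n; fun_prop)]
      refine lintegral_mono fun y => ?_
      rw [← mul_assoc]
      gcongr
      exact stieltjesKernel_le hx y
    have hTc := stieltjes_const_mul (lam := lam) hv (htm n) c x
    rw [ofReal_abs_SOp hv hvpos hwpos hhm hhfin hx (by rw [hTc]; exact ENNReal.mul_ne_top hct hTfin),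
      hTc, ENNReal.mul_rpow_of_nonneg _ _ hq.le, ENNReal.mul_rpow_of_nonneg _ _ hq.le]
    ring
  rw [heq] at hb
  have hcq0 : c ^ q ≠ 0 := (ENNReal.rpow_pos (pos_iff_ne_zero.2 hc0) hct).ne'
  have hcqt : c ^ q ≠ ∞ := ENNReal.rpow_ne_top_of_nonneg hq.le hct
  rw [← hcq, ← div_eq_mul_inv, ENNReal.le_div_iff_mul_le (.inl hcq0) (.inl hcqt), mul_comm]
  exact hb.trans le_self_add

end necessity

section kernelNorm

variable {lam p p' q : ℝ} {v w : ℝ → ℝ}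

/-- The `p'`-th power of the `L^{p'}` norm of the `x`-section of the kernel. -/
def kernelNorm (lam p' : ℝ) (v : ℝ → ℝ) (x : ℝ) : ℝ≥0∞ :=
  ∫⁻ y, (ENNReal.ofReal (v y) * stieltjesKernel lam x y) ^ p' ∂halfLine

lemma stieltjesKernel_anti (hlam : 0 < lam) {x x' : ℝ} (hx : 0 < x) (hxx' : x ≤ x') (y : ℝ) :
    stieltjesKernel lam x' y ≤ stieltjesKernel lam x y := by
  unfold stieltjesKernel
  gcongr

lemma kernelNorm_anti (hlam : 0 < lam) (hp' : 0 < p') {x x' : ℝ} (hx : 0 < x) (hxx' : x ≤ x') :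
    kernelNorm lam p' v x' ≤ kernelNorm lam p' v x := by
  unfold kernelNorm
  gcongr with y
  exact stieltjesKernel_anti hlam hx hxx' y

lemma stieltjesKernel_le_mul (hlam : 0 < lam) {x x' : ℝ} (hx : 0 < x) (hxx' : x ≤ x') (y : ℝ) :
    stieltjesKernel lam x y ≤
      ENNReal.ofReal (x' ^ lam / x ^ lam) * stieltjesKernel lam x' y := by
  have hx0 : 0 < x ^ lam := Real.rpow_pos_of_pos hx _
  have hx' : 0 < x' ^ lam := Real.rpow_pos_of_pos (hx.trans_le hxx') _
  have h1 : 1 ≤ x' ^ lam / x ^ lam :=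
    (one_le_div hx0).2 (Real.rpow_le_rpow hx.le hxx' hlam.le)
  set c := x' ^ lam / x ^ lam with hc
  have hcx : x' ^ lam = c * x ^ lam := by rw [hc, div_mul_cancel₀ _ hx0.ne']
  have hc0 : ENNReal.ofReal c ≠ 0 := by simp; linarith
  unfold stieltjesKernel
  rw [ENNReal.inv_le_iff_inv_le, ENNReal.mul_inv (.inl hc0) (.inl ENNReal.ofReal_ne_top), inv_inv,
    mul_comm, ← div_eq_mul_inv]
  refine ENNReal.div_le_of_le_mul ?_
  rw [hcx, ENNReal.ofReal_mul (by linarith), add_mul, mul_comm]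
  gcongr
  exact le_mul_of_one_le_right bot_le (by simpa using h1)

/-- A boundedness inequality forces every section of the kernel to lie in `L^{p'}`. -/
lemma kernelNorm_lt_top (hlam : 0 < lam) (hp : p.HolderConjugate p') (hq : 0 < q)
    (hv : Measurable v) {u : ℝ → ℝ≥0∞} (hu : Measurable u) (hu0 : ¬ ∀ᵐ x ∂halfLine, u x = 0)
    {K : ℝ≥0∞} (hKfin : K ≠ ∞) (hK : ∀ f : ℝ → ℝ≥0∞, Measurable f →
      ∫⁻ x, stieltjes lam v f x ^ q * u x ∂halfLine ≤ K * (∫⁻ y, f y ^ p ∂halfLine) ^ (q / p))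
    {x : ℝ} (hx : 0 < x) : kernelNorm lam p' v x < ∞ := by
  have hp'0 : 0 < p' := hp.symm.pos
  obtain ⟨M₀, hM₀⟩ : ∃ n : ℕ, ∫⁻ x in Iic (n : ℝ), u x ∂halfLine ≠ 0 := by
    by_contra! h
    refine hu0 ?_
    have h' : ∀ᵐ x ∂halfLine, ∀ n : ℕ, x ∈ Iic (n : ℝ) → u x = 0 :=
      ae_all_iff.2 fun n => (ae_restrict_iff' measurableSet_Iic).1
        ((lintegral_eq_zero_iff hu).1 (h n))
    filter_upwards [h'] with x hx
    obtain ⟨n, hn⟩ := exists_nat_ge x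
    exact hx n hn
  set M := max x M₀ with hM
  have hxM : x ≤ M := le_max_left _ _
  have hM0 : 0 < M := hx.trans_le hxM
  obtain ⟨U, hU0, hUfin, hU⟩ : ∃ U : ℝ≥0∞, U ≠ 0 ∧ U ≠ ∞ ∧ U ≤ ∫⁻ x in Iic M, u x ∂halfLine := by
    refine ⟨min 1 (∫⁻ x in Iic (M₀ : ℝ), u x ∂halfLine), ?_, ?_, ?_⟩
    · simp [min_eq_iff, hM₀]
    · exact ne_top_of_le_ne_top (by simp) (min_le_left _ _)
    · exact (min_le_right _ _).trans (lintegral_mono_set (Iic_subset_Iic.2 (le_max_right _ _)))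
  have hbound : ∀ f : ℝ → ℝ≥0∞, Measurable f → stieltjes lam v f M ≤
      (K / U) ^ (1 / q) * (∫⁻ y, f y ^ p ∂halfLine) ^ (1 / p) := fun f hf => by
    have h1 : stieltjes lam v f M ^ q * U ≤ K * (∫⁻ y, f y ^ p ∂halfLine) ^ (q / p) := by
      refine le_trans ?_ (hK f hf)
      calc _ ≤ stieltjes lam v f M ^ q * ∫⁻ x in Iic M, u x ∂halfLine := by gcongr
        _ = ∫⁻ x in Iic M, stieltjes lam v f M ^ q * u x ∂halfLine :=
            (lintegral_const_mul _ hu).symm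
        _ ≤ ∫⁻ x in Iic M, stieltjes lam v f x ^ q * u x ∂halfLine := by
            refine lintegral_mono_ae ?_
            filter_upwards [ae_restrict_of_ae ae_halfLine_pos,
              ae_restrict_mem measurableSet_Iic] with z hz hzM
            unfold stieltjes
            gcongr with y
            exact stieltjesKernel_anti hlam hz hzM y
        _ ≤ _ := setLIntegral_le_lintegral _ _
    rw [← ENNReal.le_div_iff_mul_le (.inl hU0) (.inl hUfin), mul_comm, mul_div_assoc] at h1
    have h2 := ENNReal.rpow_le_rpow h1 (one_div_pos.2 hq).le
    rw [← ENNReal.rpow_mul, mul_one_div_cancel hq.ne', ENNReal.rpow_one, mul_comm,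
      ENNReal.mul_rpow_of_nonneg _ _ (one_div_pos.2 hq).le, ← ENNReal.rpow_mul] at h2
    convert h2 using 3
    field_simp
  have hMfin : kernelNorm lam p' v M < ∞ := by
    have := measurable_stieltjesKernel lam M
    refine lintegral_rpow_lt_top_of_forall_lintegral_mul_le halfLine hp (by fun_prop)
      (K := (K / U) ^ (1 / q)) ?_ hbound
    exact ENNReal.rpow_ne_top_of_nonneg (one_div_pos.2 hq).le (ENNReal.div_ne_top hKfin hU0)
  have hc : ENNReal.ofReal (M ^ lam / x ^ lam) ^ p' ≠ ∞ :=
    ENNReal.rpow_ne_top_of_nonneg hp'0.le ENNReal.ofReal_ne_top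
  refine lt_of_le_of_lt ?_ (ENNReal.mul_lt_top hc.lt_top hMfin)
  rw [kernelNorm, kernelNorm, ← lintegral_const_mul' _ _ hc]
  refine lintegral_mono fun y => ?_
  rw [← ENNReal.mul_rpow_of_nonneg _ _ hp'0.le, mul_left_comm]
  gcongr
  exact stieltjesKernel_le_mul hlam hx hxM y

lemma stieltjes_le_kernelNorm (hp : p.HolderConjugate p') (hv : Measurable v) {f : ℝ → ℝ≥0∞}
    (hf : Measurable f) (hf1 : ∫⁻ y, f y ^ p ∂halfLine ≤ 1) (x : ℝ) :
    stieltjes lam v f x ≤ kernelNorm lam p' v x ^ (1 / p') := by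
  have := measurable_stieltjesKernel lam x
  have h := ENNReal.lintegral_mul_le_Lp_mul_Lq halfLine hp hf.aemeasurable
    (g := fun y => ENNReal.ofReal (v y) * stieltjesKernel lam x y) (by fun_prop)
  refine le_trans h (mul_le_of_le_one_left bot_le ?_)
  simpa using ENNReal.rpow_le_rpow hf1 (one_div_pos.2 hp.pos).le

end kernelNorm

section dual

variable {lam p p' : ℝ} {v w : ℝ → ℝ}

lemma lintegral_stieltjes_mul (hv : Measurable v) (hw : Measurable w) {f : ℝ → ℝ≥0∞}
    (hf : Measurable f) :
    ∫⁻ x, stieltjes lam v f x * ENNReal.ofReal (w x) ∂halfLine =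
      ∫⁻ y, f y * ((∫⁻ x, ENNReal.ofReal (w x) * stieltjesKernel lam x y ∂halfLine) *
        ENNReal.ofReal (v y)) ∂halfLine := by
  have hk := measurable_uncurry_stieltjesKernel lam
  have hk1 := measurable_stieltjesKernel lam
  have hk2 : ∀ y, Measurable fun x => stieltjesKernel lam x y := fun y => by
    simpa only [stieltjesKernel_comm] using hk1 y
  calc _ = ∫⁻ x, ∫⁻ y, f y * (ENNReal.ofReal (v y) * stieltjesKernel lam x y) *
        ENNReal.ofReal (w x) ∂halfLine ∂halfLine := by
        refine lintegral_congr fun x => (lintegral_mul_const _ ?_).symm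
        have := hk1 x
        fun_prop
    _ = ∫⁻ y, ∫⁻ x, f y * (ENNReal.ofReal (v y) * stieltjesKernel lam x y) *
        ENNReal.ofReal (w x) ∂halfLine ∂halfLine := by
        refine lintegral_lintegral_swap (Measurable.aemeasurable ?_)
        simp only [Function.uncurry_def] at hk ⊢
        fun_prop
    _ = _ := by
        refine lintegral_congr fun y => ?_
        rw [mul_comm (∫⁻ x, _ ∂_), ← lintegral_const_mul _ (by have := hk2 y; fun_prop),
          ← lintegral_const_mul _ (by have := hk2 y; fun_prop)]
        exact lintegral_congr fun x => by ring

lemma exists_lintegral_stieltjes_le_iff (hp : p.HolderConjugate p') (hv : Measurable v)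
    (hw : Measurable w) :
    (∃ K : ℝ≥0∞, K ≠ ∞ ∧ ∀ f : ℝ → ℝ≥0∞, Measurable f →
      ∫⁻ x, stieltjes lam v f x ^ (1 : ℝ) * ENNReal.ofReal (w x) ^ (1 : ℝ) ∂halfLine ≤
        K * (∫⁻ y, f y ^ p ∂halfLine) ^ (1 / p)) ↔
    ∫⁻ y, (∫⁻ x, ENNReal.ofReal (w x) * stieltjesKernel lam x y ∂halfLine) ^ p' *
        ENNReal.ofReal (v y) ^ p' ∂halfLine < ∞ := by
  have hp'0 : 0 < p' := hp.symm.pos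
  have hm : Measurable fun y => (∫⁻ x, ENNReal.ofReal (w x) * stieltjesKernel lam x y ∂halfLine) *
      ENNReal.ofReal (v y) := by
    refine (Measurable.lintegral_prod_left' (f := fun z : ℝ × ℝ =>
      ENNReal.ofReal (w z.1) * stieltjesKernel lam z.1 z.2) ?_).mul (by fun_prop)
    have hk := measurable_uncurry_stieltjesKernel lam
    fun_prop
  simp only [ENNReal.rpow_one, ← ENNReal.mul_rpow_of_nonneg _ _ hp'0.le]
  constructor
  · rintro ⟨K, hKfin, hK⟩
    refine lintegral_rpow_lt_top_of_forall_lintegral_mul_le halfLine hp hm hKfin fun f hf => ?_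
    rw [← lintegral_stieltjes_mul hv hw hf]
    exact hK f hf
  · intro h
    refine ⟨_, ENNReal.rpow_ne_top_of_nonneg (one_div_pos.2 hp'0).le h.ne, fun f hf => ?_⟩
    rw [lintegral_stieltjes_mul hv hw hf, mul_comm]
    exact ENNReal.lintegral_mul_le_Lp_mul_Lq halfLine hp hf.aemeasurable hm.aemeasurable

end dual

section sufficiency

variable {lam p p' q r : ℝ} {v w : ℝ → ℝ}

/-- The signed Stieltjes-type integral, without the outer weight. -/
def stieltjesReal (lam : ℝ) (v f : ℝ → ℝ) (x : ℝ) : ℝ :=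
  ∫ y, f y * v y / (x ^ lam + y ^ lam) ∂halfLine

lemma SOp_eq (f : ℝ → ℝ) (x : ℝ) : SOp lam v w f x = w x * stieltjesReal lam v f x := rfl

lemma lintegral_enorm_eq_stieltjes (hvpos : ∀ y, 0 ≤ v y) (f : ℝ → ℝ) {x : ℝ} (hx : 0 < x) :
    ∫⁻ y, ‖f y * v y / (x ^ lam + y ^ lam)‖ₑ ∂halfLine =
      stieltjes lam v (fun y => ENNReal.ofReal |f y|) x := by
  refine lintegral_congr_ae ?_
  filter_upwards [ae_halfLine_pos] with y hy
  have hx' : 0 < x ^ lam := Real.rpow_pos_of_pos hx _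
  have hy' : 0 < y ^ lam := Real.rpow_pos_of_pos hy _
  rw [Real.enorm_eq_ofReal_abs, abs_div, abs_mul, abs_of_nonneg (hvpos y),
    abs_of_pos (add_pos hx' hy'), ofReal_mul_div_eq hx hy (abs_nonneg _)]

lemma ofReal_abs_stieltjesReal_le (hvpos : ∀ y, 0 ≤ v y) (f : ℝ → ℝ) {x : ℝ} (hx : 0 < x) :
    ENNReal.ofReal |stieltjesReal lam v f x| ≤
      stieltjes lam v (fun y => ENNReal.ofReal |f y|) x := by
  rw [← lintegral_enorm_eq_stieltjes hvpos f hx, ← Real.enorm_eq_ofReal_abs]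
  exact enorm_integral_le_lintegral_enorm _

section unitBall

variable (hp : p.HolderConjugate p') (hv : Measurable v) {f : ℝ → ℝ} (hf : Measurable f)
  (hf1 : eN p f ≤ 1)
include hp hv hf hf1

lemma stieltjes_abs_le_kernelNorm (x : ℝ) :
    stieltjes lam v (fun y => ENNReal.ofReal |f y|) x ≤ kernelNorm lam p' v x ^ (1 / p') :=
  stieltjes_le_kernelNorm hp hv (by fun_prop) ((eN_le_one_iff hp.pos).1 hf1) x

variable (hvpos : ∀ y, 0 ≤ v y)
include hvpos

lemma integrable_stieltjes {x : ℝ} (hx : 0 < x) (hN : kernelNorm lam p' v x < ∞) :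
    Integrable (fun y => f y * v y / (x ^ lam + y ^ lam)) halfLine := by
  refine ⟨Measurable.aestronglyMeasurable (by fun_prop), ?_⟩
  rw [HasFiniteIntegral, lintegral_enorm_eq_stieltjes hvpos f hx]
  exact (stieltjes_abs_le_kernelNorm hp hv hf hf1 x).trans_lt
    (ENNReal.rpow_lt_top_of_nonneg (one_div_pos.2 hp.symm.pos).le hN.ne)

lemma abs_stieltjesReal_le {x : ℝ} (hx : 0 < x) (hN : kernelNorm lam p' v x < ∞) :
    |stieltjesReal lam v f x| ≤ (kernelNorm lam p' v x ^ (1 / p')).toReal := by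
  rw [← ENNReal.ofReal_le_iff_le_toReal
    (ENNReal.rpow_ne_top_of_nonneg (one_div_pos.2 hp.symm.pos).le hN.ne)]
  exact (ofReal_abs_stieltjesReal_le hvpos f hx).trans
    (stieltjes_abs_le_kernelNorm hp hv hf hf1 x)

/-- Equicontinuity from the right of the image of the unit ball. -/
lemma abs_stieltjesReal_sub_le (hlam : 0 < lam) {x x' : ℝ} (hx : 0 < x) (hxx' : x ≤ x')
    (hN : kernelNorm lam p' v x < ∞) :
    |stieltjesReal lam v f x - stieltjesReal lam v f x'| ≤
      (x' ^ lam - x ^ lam) / x ^ lam * (kernelNorm lam p' v x ^ (1 / p')).toReal := by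
  have hx' : 0 < x' := hx.trans_le hxx'
  have hxl : 0 < x ^ lam := Real.rpow_pos_of_pos hx _
  have hle : x ^ lam ≤ x' ^ lam := Real.rpow_le_rpow hx.le hxx' hlam.le
  have hN' : kernelNorm lam p' v x' < ∞ := (kernelNorm_anti hlam hp.symm.pos hx hxx').trans_lt hN
  have hi := integrable_stieltjes hp hv hf hf1 hvpos hx hN
  have hi' := integrable_stieltjes hp hv hf hf1 hvpos hx' hN'
  have hNfin := ENNReal.rpow_ne_top_of_nonneg (one_div_pos.2 hp.symm.pos).le hN.ne
  rw [stieltjesReal, stieltjesReal, ← integral_sub hi hi', ← Real.norm_eq_abs]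
  calc _ ≤ ∫ y, ‖f y * v y / (x ^ lam + y ^ lam) - f y * v y / (x' ^ lam + y ^ lam)‖ ∂halfLine :=
        norm_integral_le_integral_norm _
    _ ≤ ∫ y, (x' ^ lam - x ^ lam) / x ^ lam * ‖f y * v y / (x ^ lam + y ^ lam)‖ ∂halfLine := by
        refine integral_mono_ae (hi.sub hi').norm (hi.norm.const_mul _) ?_
        filter_upwards [ae_halfLine_pos] with y hy
        have hyl : 0 < y ^ lam := Real.rpow_pos_of_pos hy _
        have heq : f y * v y / (x ^ lam + y ^ lam) - f y * v y / (x' ^ lam + y ^ lam) =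
            (x' ^ lam - x ^ lam) / (x' ^ lam + y ^ lam) * (f y * v y / (x ^ lam + y ^ lam)) := by
          have : x' ^ lam + y ^ lam ≠ 0 := by linarith
          field_simp
          ring
        rw [heq, norm_mul, Real.norm_of_nonneg (div_nonneg (sub_nonneg.2 hle) (by linarith))]
        gcongr
        linarith
    _ = (x' ^ lam - x ^ lam) / x ^ lam * ∫ y, ‖f y * v y / (x ^ lam + y ^ lam)‖ ∂halfLine :=
        integral_const_mul _ _
    _ ≤ _ := by
        have h0 : 0 ≤ x' ^ lam - x ^ lam := sub_nonneg.2 hle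
        gcongr
        rw [integral_norm_eq_lintegral_enorm hi.1, lintegral_enorm_eq_stieltjes hvpos f hx]
        exact ENNReal.toReal_mono hNfin (stieltjes_abs_le_kernelNorm hp hv hf hf1 x)

end unitBall

lemma exists_subseq_cauchySeq (hlam : 0 < lam) (hp : p.HolderConjugate p') (hv : Measurable v)
    (hvpos : ∀ y, 0 ≤ v y) (hN : ∀ x, 0 < x → kernelNorm lam p' v x < ∞) {f : ℕ → ℝ → ℝ}
    (hf : ∀ n, Measurable (f n)) (hf1 : ∀ n, eN p (f n) ≤ 1) :
    ∃ φ : ℕ → ℕ, StrictMono φ ∧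
      ∀ x, 0 < x → CauchySeq fun n => stieltjesReal lam v (f (φ n)) x := by
  let C : ℝ → ℝ := fun x => (kernelNorm lam p' v x ^ (1 / p')).toReal
  have hcpt : IsCompact (univ.pi fun a : {a : ℚ // 0 < a} => Icc (-C a) (C a)) :=
    isCompact_univ_pi fun a => isCompact_Icc
  have hpos : ∀ a : {a : ℚ // 0 < a}, (0 : ℝ) < (a : ℚ) := fun a => by exact_mod_cast a.2
  obtain ⟨L, -, φ, hφ, hL⟩ := hcpt.tendsto_subseq
    (x := fun n (a : {a : ℚ // 0 < a}) => stieltjesReal lam v (f n) (a : ℚ)) fun n a _ =>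
      abs_le.1 (abs_stieltjesReal_le hp hv (hf n) (hf1 n) hvpos (hpos a) (hN _ (hpos a)))
  refine ⟨φ, hφ, fun x hx => Metric.cauchySeq_iff'.2 fun ε hε => ?_⟩
  have hcont : Tendsto (fun x' => (x' ^ lam - x ^ lam) / x ^ lam * C x) (𝓝[>] x) (𝓝 0) := by
    have : ContinuousAt (fun x' => (x' ^ lam - x ^ lam) / x ^ lam * C x) x := by
      have := Real.continuousAt_rpow_const x lam (.inl hx.ne')
      fun_prop
    simpa using this.tendsto.mono_left nhdsWithin_le_nhds
  obtain ⟨b, hb, hbs⟩ := (mem_nhdsGT_iff_exists_Ioo_subset).1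
    (hcont.eventually_lt_const (show (0 : ℝ) < ε / 3 by positivity))
  obtain ⟨a, hxa, hab⟩ := exists_rat_btwn (mem_Ioi.1 hb)
  have hsmall : (((a : ℝ) ^ lam - x ^ lam) / x ^ lam) * C x < ε / 3 := hbs ⟨hxa, hab⟩
  have hclose : ∀ n, |stieltjesReal lam v (f n) x - stieltjesReal lam v (f n) a| < ε / 3 := fun n =>
    (abs_stieltjesReal_sub_le hp hv (hf n) (hf1 n) hvpos hlam hx hxa.le (hN x hx)).trans_lt hsmall
  have ha0 : 0 < a := by exact_mod_cast hx.trans hxa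
  have hLa := (tendsto_pi_nhds.1 hL ⟨a, ha0⟩).cauchySeq
  obtain ⟨N, hNa⟩ := Metric.cauchySeq_iff'.1 hLa (ε / 3) (by positivity)
  refine ⟨N, fun n hn => ?_⟩
  have h1 := hclose (φ n)
  have h2 := hNa n hn
  have h3 := hclose (φ N)
  simp only [Real.dist_eq, Function.comp_apply, abs_lt] at h1 h2 h3 ⊢
  constructor <;> linarith

/-- The compact sets `[1/(k+1), k+1]` exhausting the half-line. -/
def exhaust (k : ℕ) : Set ℝ := Icc (1 / ((k : ℝ) + 1)) (k + 1)

lemma measurableSet_exhaust (k : ℕ) : MeasurableSet (exhaust k) := measurableSet_Icc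

lemma eventually_mem_exhaust {x : ℝ} (hx : 0 < x) : ∀ᶠ k in atTop, x ∈ exhaust k := by
  have h1 := (tendsto_one_div_add_atTop_nhds_zero_nat (𝕜 := ℝ)).eventually_le_const hx
  filter_upwards [h1, (tendsto_natCast_atTop_atTop (R := ℝ)).eventually_ge_atTop x] with k hk hk'
  exact ⟨hk, by linarith⟩

lemma tendsto_lintegral_indicator_exhaust_compl {G : ℝ → ℝ≥0∞} (hG : Measurable G)
    (hfin : ∫⁻ t, G t ∂halfLine ≠ ∞) :
    Tendsto (fun k => ∫⁻ t, (exhaust k)ᶜ.indicator G t ∂halfLine) atTop (𝓝 0) := by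
  rw [← lintegral_zero (μ := halfLine)]
  refine tendsto_lintegral_of_dominated_convergence G
    (fun k => hG.indicator (measurableSet_exhaust k).compl)
    (fun k => ae_of_all _ fun t => indicator_le_self _ _ t) hfin ?_
  filter_upwards [ae_halfLine_pos] with t ht
  refine tendsto_const_nhds.congr' ?_
  filter_upwards [eventually_mem_exhaust ht] with k hk
  rw [indicator_of_notMem (by simpa using hk)]

lemma stieltjesBH_indicator_le (hp : 0 < p) (hr : 0 < r) (s : Set ℝ) (u : ℝ → ℝ≥0∞) :
    stieltjesBH lam p p' q r v (s.indicator u) ≤ ∫⁻ t, s.indicator (fun t =>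
      (∫⁻ y in Iio t, ENNReal.ofReal (v y) ^ p' ∂halfLine) ^ (r / p') *
        (∫⁻ x in Ioi t, ENNReal.ofReal x ^ (-(lam * q)) * u x ∂halfLine) ^ (r / p) *
        (ENNReal.ofReal t ^ (-(lam * q)) * u t)) t ∂halfLine := by
  refine lintegral_mono fun t => ?_
  by_cases ht : t ∈ s
  · rw [indicator_of_mem ht]
    exact mul_le_mul' (mul_le_mul' le_rfl (ENNReal.rpow_le_rpow (lintegral_mono fun x =>
      mul_le_mul_right (indicator_le_self s u x) _) (div_pos hr hp).le))
      (mul_le_mul_right (indicator_le_self s u t) _)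
  · simp [ht]

lemma stieltjesBHadj_indicator_le (hp : 0 < p) (hr : 0 < r) (s : Set ℝ) (u : ℝ → ℝ≥0∞) :
    stieltjesBHadj lam p p' r v (s.indicator u) ≤ ∫⁻ t, s.indicator (fun t =>
      (∫⁻ y in Ioi t, (ENNReal.ofReal y ^ (-lam) * ENNReal.ofReal (v y)) ^ p' ∂halfLine) ^ (r / p') *
        (∫⁻ x in Iio t, u x ∂halfLine) ^ (r / p) * u t) t ∂halfLine := by
  refine lintegral_mono fun t => ?_
  by_cases ht : t ∈ s
  · rw [indicator_of_mem ht, indicator_of_mem ht]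
    exact mul_le_mul' (mul_le_mul' le_rfl (ENNReal.rpow_le_rpow (lintegral_mono fun x =>
      indicator_le_self s u x) (div_pos hr hp).le)) le_rfl
  · simp [ht]

lemma tendsto_stieltjesBH (hp : 0 < p) (hr : 0 < r) {u : ℝ → ℝ≥0∞} (hu : Measurable u)
    (h : stieltjesBH lam p p' q r v u < ∞) :
    Tendsto (fun k => stieltjesBH lam p p' q r v ((exhaust k)ᶜ.indicator u)) atTop (𝓝 0) := by
  refine tendsto_of_tendsto_of_tendsto_of_le_of_le tendsto_const_nhds
    (tendsto_lintegral_indicator_exhaust_compl ?_ h.ne) (fun k => bot_le)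
    (fun k => stieltjesBH_indicator_le hp hr _ u)
  exact (((measurable_setLIntegral_Iio _ _).pow_const _).mul
    ((measurable_setLIntegral_Ioi _ _).pow_const _)).mul (by fun_prop)

lemma tendsto_stieltjesBHadj (hp : 0 < p) (hr : 0 < r) {u : ℝ → ℝ≥0∞} (hu : Measurable u)
    (h : stieltjesBHadj lam p p' r v u < ∞) :
    Tendsto (fun k => stieltjesBHadj lam p p' r v ((exhaust k)ᶜ.indicator u)) atTop (𝓝 0) := by
  refine tendsto_of_tendsto_of_tendsto_of_le_of_le tendsto_const_nhds
    (tendsto_lintegral_indicator_exhaust_compl ?_ h.ne) (fun k => bot_le)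
    (fun k => stieltjesBHadj_indicator_le hp hr _ u)
  exact (((measurable_setLIntegral_Ioi _ _).pow_const _).mul
    ((measurable_setLIntegral_Iio _ _).pow_const _)).mul hu

lemma setLIntegral_exhaust_ne_top (hq : 0 < q) (hwpos : ∀ x, 0 ≤ w x)
    (hlocw : LocallyIntegrableOn (fun x => w x ^ q) (Ioi (0:ℝ))) (k : ℕ) :
    ∫⁻ x in exhaust k, ENNReal.ofReal (w x) ^ q ∂halfLine ≠ ∞ := by
  have hsub : exhaust k ⊆ Ioi 0 := fun x hx => lt_of_lt_of_le Nat.one_div_pos_of_nat hx.1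
  have hi := (hlocw.integrableOn_compact_subset hsub isCompact_Icc).2
  rw [halfLine, Measure.restrict_restrict (measurableSet_exhaust k), inter_eq_left.2 hsub]
  rw [HasFiniteIntegral] at hi
  refine ne_top_of_le_ne_top hi.ne (lintegral_mono fun x => le_of_eq ?_)
  rw [Real.enorm_eq_ofReal_abs, abs_of_nonneg (Real.rpow_nonneg (hwpos x) q),
    ENNReal.ofReal_rpow_of_nonneg (hwpos x) hq.le]

/-- Uniform smallness of the tails of the image of the unit ball. -/
lemma exists_setLIntegral_exhaust_compl_lt (hp : p.HolderConjugate p') (hq : 0 < q) (hr : 0 < r)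
    (hpqr : r / p + 1 = r / q) (hv : Measurable v) (hw : Measurable w) (hvpos : ∀ y, 0 ≤ v y)
    (hwpos : ∀ x, 0 ≤ w x)
    (hB : stieltjesBH lam p p' q r v (fun x => ENNReal.ofReal (w x) ^ q) < ∞)
    (hB' : stieltjesBHadj lam p p' r v (fun x => ENNReal.ofReal (w x) ^ q) < ∞)
    {δ : ℝ≥0∞} (hδ : 0 < δ) :
    ∃ k, ∀ f, Measurable f → eN p f ≤ 1 →
      ∫⁻ x in (exhaust k)ᶜ, ENNReal.ofReal |SOp lam v w f x| ^ q ∂halfLine < δ := by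
  have hu : Measurable fun x => ENNReal.ofReal (w x) ^ q := by fun_prop
  have hpow : Tendsto (fun a : ℝ≥0∞ => a ^ (q / r)) (𝓝 0) (𝓝 0) := by
    have := (ENNReal.continuous_rpow_const (y := q / r)).tendsto 0
    rwa [ENNReal.zero_rpow_of_pos (div_pos hq hr)] at this
  have hlim := ENNReal.Tendsto.const_mul (a := 2 ^ q * (4 ^ q * ENNReal.ofReal (r / q) ^ (q / r)))
    ((hpow.comp (tendsto_stieltjesBH hp.pos hr hu hB)).add
      (hpow.comp (tendsto_stieltjesBHadj hp.pos hr hu hB')))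
    (.inr (ENNReal.mul_ne_top (by simp) (ENNReal.mul_ne_top (by simp)
      (ENNReal.rpow_ne_top_of_nonneg (div_pos hq hr).le ENNReal.ofReal_ne_top))))
  rw [add_zero, mul_zero] at hlim
  obtain ⟨k, hk⟩ := (hlim.eventually_lt_const hδ).exists
  refine ⟨k, fun f hf hf1 => lt_of_le_of_lt ?_ hk⟩
  have hE := (measurableSet_exhaust k).compl
  have hfm : Measurable fun y => ENNReal.ofReal |f y| := by fun_prop
  have hf1' := (eN_le_one_iff hp.pos).1 hf1
  rw [← lintegral_indicator hE]
  calc _ ≤ ∫⁻ x, stieltjes lam v (fun y => ENNReal.ofReal |f y|) x ^ q *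
        (exhaust k)ᶜ.indicator (fun x => ENNReal.ofReal (w x) ^ q) x ∂halfLine := by
        refine lintegral_mono_ae ?_
        filter_upwards [ae_halfLine_pos] with x hx
        by_cases hxE : x ∈ (exhaust k)ᶜ
        · rw [indicator_of_mem hxE, indicator_of_mem hxE, SOp_eq, abs_mul,
            abs_of_nonneg (hwpos x), ENNReal.ofReal_mul (hwpos x),
            ENNReal.mul_rpow_of_nonneg _ _ hq.le, mul_comm]
          gcongr
          exact ofReal_abs_stieltjesReal_le hvpos f hx
        · rw [indicator_of_notMem hxE]
          exact bot_le
    _ ≤ _ := lintegral_stieltjes_rpow_le hp hq hr hpqr hv (hu.indicator hE) hfm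
    _ ≤ _ := by
        refine mul_le_of_le_one_right bot_le ?_
        simpa using ENNReal.rpow_le_rpow hf1' (div_pos hq hp.pos).le

lemma tendsto_setLIntegral_exhaust (hlam : 0 < lam) (hp : p.HolderConjugate p') (hq : 0 < q)
    (hv : Measurable v) (hw : Measurable w) (hvpos : ∀ y, 0 ≤ v y) (hwpos : ∀ x, 0 ≤ w x)
    (hlocw : LocallyIntegrableOn (fun x => w x ^ q) (Ioi (0:ℝ)))
    (hN : ∀ x, 0 < x → kernelNorm lam p' v x < ∞) {f : ℕ → ℝ → ℝ}
    (hf : ∀ n, Measurable (f n)) (hf1 : ∀ n, eN p (f n) ≤ 1)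
    (hC : ∀ x, 0 < x → CauchySeq fun n => stieltjesReal lam v (f n) x) (k : ℕ) :
    Tendsto (fun z : ℕ × ℕ => ∫⁻ x in exhaust k,
      ENNReal.ofReal |SOp lam v w (f z.1) x - SOp lam v w (f z.2) x| ^ q ∂halfLine)
      atTop (𝓝 0) := by
  have hm : ∀ n, Measurable (SOp lam v w (f n)) := fun n => measurable_SOp hv hw (hf n)
  have hk0 : 0 < 1 / ((k : ℝ) + 1) := Nat.one_div_pos_of_nat
  have hp'0 : 0 < p' := hp.symm.pos
  set B := kernelNorm lam p' v (1 / ((k : ℝ) + 1)) ^ (1 / p') with hBdef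
  have hBfin : B ≠ ∞ := ENNReal.rpow_ne_top_of_nonneg (one_div_pos.2 hp'0).le (hN _ hk0).ne
  have hpt : ∀ (z : ℕ × ℕ) (x : ℝ), ENNReal.ofReal |SOp lam v w (f z.1) x - SOp lam v w (f z.2) x|
      = ENNReal.ofReal (w x * dist (stieltjesReal lam v (f z.1) x)
        (stieltjesReal lam v (f z.2) x)) := fun z x => by
    rw [SOp_eq, SOp_eq, ← mul_sub, abs_mul, abs_of_nonneg (hwpos x), Real.dist_eq]
  have hF : ∀ n, ∀ x ∈ exhaust k, ENNReal.ofReal |stieltjesReal lam v (f n) x| ≤ B := by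
    intro n x hx
    have hx0 : 0 < x := hk0.trans_le hx.1
    refine (ofReal_abs_stieltjesReal_le hvpos (f n) hx0).trans
      ((stieltjes_abs_le_kernelNorm hp hv (hf n) (hf1 n) x).trans ?_)
    exact ENNReal.rpow_le_rpow (kernelNorm_anti hlam hp'0 hk0 hx.1) (one_div_pos.2 hp'0).le
  have key := tendsto_lintegral_filter_of_dominated_convergence (l := (atTop : Filter (ℕ × ℕ)))
    (μ := halfLine.restrict (exhaust k)) (f := fun _ => 0)
    (F := fun z x => ENNReal.ofReal |SOp lam v w (f z.1) x - SOp lam v w (f z.2) x| ^ q)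
    (fun x => ENNReal.ofReal (w x) ^ q * (B + B) ^ q) (.of_forall fun z => ?_)
    (.of_forall fun z => ?_) ?_ ?_
  · simpa using key
  · have := hm z.1
    have := hm z.2
    fun_prop
  · filter_upwards [ae_restrict_mem (measurableSet_exhaust k)] with x hx
    rw [hpt, ENNReal.ofReal_mul (hwpos x), ENNReal.mul_rpow_of_nonneg _ _ hq.le]
    gcongr
    calc _ ≤ ENNReal.ofReal (|stieltjesReal lam v (f z.1) x| + |stieltjesReal lam v (f z.2) x|) :=
          ENNReal.ofReal_le_ofReal (abs_sub _ _)
      _ ≤ _ := by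
          rw [ENNReal.ofReal_add (abs_nonneg _) (abs_nonneg _)]
          exact add_le_add (hF _ x hx) (hF _ x hx)
  · rw [lintegral_mul_const _ (by fun_prop)]
    exact ENNReal.mul_ne_top (setLIntegral_exhaust_ne_top hq hwpos hlocw k)
      (ENNReal.rpow_ne_top_of_nonneg hq.le (by simp [hBfin]))
  · filter_upwards [ae_restrict_of_ae ae_halfLine_pos] with x hx
    have h0 := (cauchySeq_iff_tendsto_dist_atTop_0.1 (hC x hx)).const_mul (w x)
    have h1 := ((ENNReal.continuous_rpow_const (y := q)).comp ENNReal.continuous_ofReal).tendsto _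
      |>.comp h0
    simpa [Function.comp_def, hpt, hq] using h1

theorem SCompact.of_stieltjesBH_lt_top (hlam : 0 < lam) (hp : p.HolderConjugate p') (hq : 0 < q)
    (hr : 0 < r) (hpqr : r / p + 1 = r / q) (hv : Measurable v) (hw : Measurable w)
    (hvpos : ∀ y, 0 ≤ v y) (hwpos : ∀ x, 0 ≤ w x)
    (hlocw : LocallyIntegrableOn (fun x => w x ^ q) (Ioi (0:ℝ)))
    (hB : stieltjesBH lam p p' q r v (fun x => ENNReal.ofReal (w x) ^ q) < ∞)
    (hB' : stieltjesBHadj lam p p' r v (fun x => ENNReal.ofReal (w x) ^ q) < ∞) :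
    SCompact lam p q v w := by
  intro f hf hf1
  have hu : Measurable fun x => ENNReal.ofReal (w x) ^ q := by fun_prop
  have hm : ∀ n, Measurable (SOp lam v w (f n)) := fun n => measurable_SOp hv hw (hf n)
  by_cases hu0 : ∀ᵐ x ∂halfLine, ENNReal.ofReal (w x) ^ q = 0
  · refine ⟨id, strictMono_id, fun ε hε => ⟨0, fun m _ n _ => ?_⟩⟩
    obtain ⟨δ, hδ, h⟩ := exists_forall_lqPow_lt_dS_lt hq hε
    refine h _ (lt_of_eq_of_lt ?_ hδ)
    rw [lqPow, ← lintegral_zero (μ := halfLine)]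
    refine lintegral_congr_ae ?_
    filter_upwards [hu0] with x hx
    have hwx : w x = 0 := by
      have : w x ≤ 0 := by simpa [hq, hq.not_gt] using hx
      exact le_antisymm this (hwpos x)
    simp [SOp, hwx, hq]
  have hr' : 0 < q / r := div_pos hq hr
  have hN : ∀ x, 0 < x → kernelNorm lam p' v x < ∞ := fun x hx =>
    kernelNorm_lt_top hlam hp hq hv hu hu0
      (ENNReal.mul_ne_top (ENNReal.mul_ne_top (by simp) (ENNReal.mul_ne_top (by simp)
        (ENNReal.rpow_ne_top_of_nonneg hr'.le ENNReal.ofReal_ne_top)))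
        (ENNReal.add_ne_top.2 ⟨ENNReal.rpow_ne_top_of_nonneg hr'.le hB.ne,
          ENNReal.rpow_ne_top_of_nonneg hr'.le hB'.ne⟩))
      (fun g hg => lintegral_stieltjes_rpow_le hp hq hr hpqr hv hu hg) hx
  obtain ⟨φ, hφ, hC⟩ := exists_subseq_cauchySeq hlam hp hv hvpos hN hf hf1
  refine ⟨φ, hφ, fun ε hε => ?_⟩
  obtain ⟨δ, hδ, hdS⟩ := exists_forall_lqPow_lt_dS_lt hq hε
  obtain ⟨η, hη, hηδ⟩ : ∃ η : ℝ≥0∞, 0 < η ∧ 2 ^ q * (η + η) < δ / 2 := by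
    have ht : Tendsto (fun η : ℝ≥0∞ => 2 ^ q * (η + η)) (𝓝[>] 0) (𝓝 0) := by
      have := ENNReal.Tendsto.const_mul (a := 2 ^ q) ((tendsto_id (α := ℝ≥0∞) (x := 𝓝 0)).add
        tendsto_id) (.inr (by simp))
      simpa using this.mono_left nhdsWithin_le_nhds
    obtain ⟨η, h1, h2⟩ := ((ht.eventually_lt_const (ENNReal.half_pos hδ.ne')).and self_mem_nhdsWithin).exists
    exact ⟨η, h2, h1⟩
  obtain ⟨k, hk⟩ :=
    exists_setLIntegral_exhaust_compl_lt hp hq hr hpqr hv hw hvpos hwpos hB hB' hη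
  have hlim := tendsto_setLIntegral_exhaust hlam hp hq hv hw hvpos hwpos hlocw hN
    (fun n => hf (φ n)) (fun n => hf1 (φ n)) hC k
  obtain ⟨⟨N₁, N₂⟩, hNN⟩ := eventually_atTop.1
    (hlim.eventually_lt_const (ENNReal.half_pos hδ.ne'))
  refine ⟨max N₁ N₂, fun m hm' n hn' => hdS _ ?_⟩
  have hE := measurableSet_exhaust k
  rw [lqPow, ← lintegral_add_compl _ hE, ← ENNReal.add_halves δ]
  refine ENNReal.add_lt_add (hNN (m, n) ⟨(le_max_left _ _).trans hm', (le_max_right _ _).trans hn'⟩)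
    (lt_of_le_of_lt ?_ hηδ)
  calc _ ≤ ∫⁻ x in (exhaust k)ᶜ, 2 ^ q * (ENNReal.ofReal |SOp lam v w (f (φ m)) x| ^ q +
        ENNReal.ofReal |SOp lam v w (f (φ n)) x| ^ q) ∂halfLine := by
        refine lintegral_mono fun x => le_trans (ENNReal.rpow_le_rpow ?_ hq.le)
          (ENNReal.add_rpow_le hq _ _)
        rw [← ENNReal.ofReal_add (abs_nonneg _) (abs_nonneg _)]
        exact ENNReal.ofReal_le_ofReal (abs_sub _ _)
    _ = 2 ^ q * (_ + _) := by
        rw [lintegral_const_mul' _ _ (by simp), lintegral_add_left]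
        have := hm (φ m)
        fun_prop
    _ ≤ _ := mul_le_mul_right (add_le_add (hk _ (hf _) (hf1 _)).le (hk _ (hf _) (hf1 _)).le) _

end sufficiency

theorem stmt15 (lam p q : ℝ) (hlam : 0 < lam) (hq0 : 0 < q) (hqp : q < p) (hp : 1 < p)
    (p' r : ℝ) (hp' : p' = p / (p - 1)) (hr : r = p * q / (p - q))
    (v w : ℝ → ℝ) (hv : Measurable v) (hw : Measurable w)
    (hvpos : ∀ y, 0 ≤ v y) (hwpos : ∀ x, 0 ≤ w x)
    (hlocv : LocallyIntegrableOn (fun y => v y ^ p') (Ioi (0:ℝ)))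
    (hlocw : LocallyIntegrableOn (fun x => w x ^ q) (Ioi (0:ℝ)))
    (BHv BHsv Λ : ℝ≥0∞)
    -- `B_H = (∫_0^∞ V₀(t)^{r/p'} 𝒲_t(∞)^{r/p} t^{-λq} w(t)^q dt)^{1/r}`
    (hBH : BHv = (∫⁻ t in Ioi (0:ℝ), (V0 p' v t) ^ (r/p') * (Winf lam q w t) ^ (r/p)
      * (ENNReal.ofReal t) ^ (-(lam * q)) * ENNReal.ofReal (w t) ^ q) ^ (1/r))
    -- `B_{H*} = (∫_0^∞ 𝒱_t(∞)^{r/p'} W₀(t)^{r/p} w(t)^q dt)^{1/r}`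
    (hBHs : BHsv = (∫⁻ t in Ioi (0:ℝ), (Vinf lam p' v t) ^ (r/p') * (W0 q w t) ^ (r/p)
      * ENNReal.ofReal (w t) ^ q) ^ (1/r))
    -- `Λ = (∫_0^∞ (∫_0^∞ w(x)/(x^λ+y^λ) dx)^{p'} v(y)^{p'} dy)^{1/p'}`
    (hΛ : Λ = (∫⁻ y in Ioi (0:ℝ), (∫⁻ x in Ioi (0:ℝ),
      ENNReal.ofReal (w x) / (ENNReal.ofReal (x ^ lam) + ENNReal.ofReal (y ^ lam))) ^ p'
        * ENNReal.ofReal (v y) ^ p') ^ (1/p')) :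
    (q ≠ 1 → (SCompact lam p q v w ↔ BHv + BHsv < ⊤))
      ∧ (q = 1 → (SCompact lam p q v w ↔ Λ < ⊤)) := by
  have hp0 : 0 < p := one_pos.trans hp
  have hpq : 0 < p - q := sub_pos.2 hqp
  have hpp : p.HolderConjugate p' := by
    rw [hp']
    exact Real.HolderConjugate.conjExponent hp
  have hr0 : 0 < r := by rw [hr]; positivity
  have hpqr : r / p + 1 = r / q := by
    rw [hr]
    field_simp
    ring
  have hu : Measurable fun x => ENNReal.ofReal (w x) ^ q := by fun_prop
  rw [← stieltjesBH_eq] at hBH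
  rw [← stieltjesBHadj_eq lam p hpp.symm.pos] at hBHs
  have hB : BHv + BHsv < ⊤ ↔ stieltjesBH lam p p' q r v (fun x => ENNReal.ofReal (w x) ^ q) < ∞ ∧
      stieltjesBHadj lam p p' r v (fun x => ENNReal.ofReal (w x) ^ q) < ∞ := by
    rw [ENNReal.add_lt_top, hBH, hBHs, ENNReal.rpow_lt_top_iff_of_pos (one_div_pos.2 hr0),
      ENNReal.rpow_lt_top_iff_of_pos (one_div_pos.2 hr0)]
  have hbdd : SCompact lam p q v w → ∃ K : ℝ≥0∞, K ≠ ∞ ∧ ∀ f : ℝ → ℝ≥0∞, Measurable f →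
      ∫⁻ x, stieltjes lam v f x ^ q * ENNReal.ofReal (w x) ^ q ∂halfLine ≤
        K * (∫⁻ y, f y ^ p ∂halfLine) ^ (q / p) :=
    fun hS => hS.exists_lintegral_stieltjes_le hp0 hq0 hv hw hvpos hwpos
  have hcpt : (∃ K : ℝ≥0∞, K ≠ ∞ ∧ ∀ f : ℝ → ℝ≥0∞, Measurable f →
      ∫⁻ x, stieltjes lam v f x ^ q * ENNReal.ofReal (w x) ^ q ∂halfLine ≤
        K * (∫⁻ y, f y ^ p ∂halfLine) ^ (q / p)) → BHv + BHsv < ⊤ := by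
    rintro ⟨K, hKfin, hK⟩
    exact hB.2 ⟨stieltjesBH_lt_top hpp hq0 hr0 hpqr hv hu hlam hKfin hK,
      stieltjesBHadj_lt_top hpp hq0 hr0 hpqr hv hu hlam hKfin hK⟩
  have hsuff : BHv + BHsv < ⊤ → SCompact lam p q v w := fun h =>
    .of_stieltjesBH_lt_top hlam hpp hq0 hr0 hpqr hv hw hvpos hwpos hlocw (hB.1 h).1 (hB.1 h).2
  refine ⟨fun _ => ⟨fun h => hcpt (hbdd h), hsuff⟩, fun hq1 => ?_⟩
  subst hq1
  rw [hΛ, ENNReal.rpow_lt_top_iff_of_pos (one_div_pos.2 hpp.symm.pos)]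
  have hdual := exists_lintegral_stieltjes_le_iff (lam := lam) hpp hv hw
  exact ⟨fun h => hdual.1 (hbdd h), fun h => hsuff (hcpt (hdual.2 h))⟩
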